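/- (Large grains retained.) Fix λ > 0 and a Borel probability measure F on [0,∞) with ∫ r^d F(dr) < ∞ that follows a power law with tail exponent α > d, so F̄(r) = ℓ(r)·r^{−α} with ℓ slowly varying. Define h(r) = exp(−λ ∫_{[r,∞)} |B_{r+s}(0)| F(ds)); h₂(u, r₁, r₂) = 0 if u ≤ r₁+r₂ and h₂(u, r₁, r₂) = h(r₁)·h(r₂)·exp(λ ∫_{[max(r₁,r₂),∞)} |B_{r₁+s}(0) ∩ B_{r₂+s}(u·e₁)| F(ds)) if u > r₁+r₂; q(u,r₁,r₂) = h₂(u,r₁,r₂) − h(r₁)h(r₂); λ_th = λ ∫ h(r) F(dr); F̄_th(r) = (λ/λ_th) ∫_{(r,∞)} h(s) F(ds); p_th = λ ∫ |B_r(0)| h(r) F(dr); k_th(z) = λ ∫ |B_r(0) ∩ B_r(z)| h(r) F(dr) + λ² ∭ |B_{r₁}(0) ∩ B_{r₂}(x)|·q(|x−z|, r₁, r₂) dx F(dr₁) F(dr₂); and ξ_th(z) = (λ/λ_th)² ∬ q(|z|, r₁, r₂) F(dr₁) F(dr₂). Then: (i) F̄_th(r)/((λ/λ_th)·ℓ(r)·r^{−α})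 → 1 as r → ∞; (ii) k_th(z)/(λ·c_{α,d}·(1−p_th)²·ℓ(|z|)·|z|^{−(α−d)}) → 1 as |z| → ∞; and (iii) ξ_th(z)/(λ·c_{α,d}·ℓ(|z|)·|z|^{−(α−d)}) → 1 as |z| → ∞, where c_{α,d} = ∫₀^∞ |B_r(0) ∩ B_r(e₁)|·α·r^{−α−1} dr. -/

import Mathlib

open MeasureTheory Filter Set Metric ProbabilityTheory

noncomputable section

/-- A measurable positive function is slowly varying at infinity if `ℓ(a t)/ℓ(t) → 1`
as `t → ∞` for every `a > 0`. -/
def SlowlyVarying (ℓ : ℝ → ℝ) : Prop :=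
  Measurable ℓ ∧ (∀ x > 0, 0 < ℓ x) ∧
    ∀ a > 0, Tendsto (fun t => ℓ (a * t) / ℓ t) atTop (nhds 1)

/-- Tail function `F̄(x) = F((x,∞))` of a measure on `ℝ`. -/
def tailF (F : Measure ℝ) (x : ℝ) : ℝ := (F (Ioi x)).toReal

/-- `d`-dimensional Euclidean space. -/
abbrev Euc (d : ℕ) := EuclideanSpace ℝ (Fin d)

/-- The first standard basis vector of `ℝ^d`. -/
def e1 (d : ℕ) : Euc d := if h : 0 < d then EuclideanSpace.single (⟨0, h⟩ : Fin d) 1 else 0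

/-- Volume of the closed ball of radius `r` in `ℝ^d`. -/
def ballVol (d : ℕ) (r : ℝ) : ℝ := (volume (closedBall (0 : Euc d) r)).toReal

/-- Volume of the intersection of closed balls `B_r(x)` and `B_s(y)` in `ℝ^d`. -/
def interVol (d : ℕ) (x : Euc d) (r : ℝ) (y : Euc d) (s : ℝ) : ℝ :=
  (volume (closedBall x r ∩ closedBall y s)).toReal

/-- The constant `c_{α,d} = ∫₀^∞ |B_r(0) ∩ B_r(e₁)| α r^{-α-1} dr`. -/
def cconst (d : ℕ) (α : ℝ) : ℝ :=
  ∫ r in Ioi (0 : ℝ), interVol d 0 r (e1 d) r * (α * r ^ (-α - 1))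

/-- Retention probability for the large-retained thinning. -/
def hL (d : ℕ) (lam : ℝ) (F : Measure ℝ) (r : ℝ) : ℝ :=
  Real.exp (-(lam * ∫ s in Ici r, ballVol d (r + s) ∂F))

/-- Pair retention probability for the large-retained thinning. -/
def h2L (d : ℕ) (lam : ℝ) (F : Measure ℝ) (u r₁ r₂ : ℝ) : ℝ :=
  if u ≤ r₁ + r₂ then 0
  else hL d lam F r₁ * hL d lam F r₂ *
    Real.exp (lam * ∫ s in Ici (max r₁ r₂),
      interVol d 0 (r₁ + s) (u • e1 d) (r₂ + s) ∂F)

/-- Retention covariance for the large-retained thinning. -/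
def qL (d : ℕ) (lam : ℝ) (F : Measure ℝ) (u r₁ r₂ : ℝ) : ℝ :=
  h2L d lam F u r₁ r₂ - hL d lam F r₁ * hL d lam F r₂

/-- Thinned germ density `λ_th = λ ∫ h(r) F(dr)`. -/
def lamth (lam : ℝ) (F : Measure ℝ) (h : ℝ → ℝ) : ℝ := lam * ∫ r, h r ∂F

/-- Tail distribution `F̄_th(r) = (λ/λ_th) ∫_{(r,∞)} h(s) F(ds)` of the radius of a
typical grain in the thinned model. -/
def tailth (lam : ℝ) (F : Measure ℝ) (h : ℝ → ℝ) (r : ℝ) : ℝ :=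
  (lam / lamth lam F h) * ∫ s in Ioi r, h s ∂F

/-- Volume fraction `p_th = λ ∫ |B_r(0)| h(r) F(dr)` of the thinned grain cover. -/
def pth (d : ℕ) (lam : ℝ) (F : Measure ℝ) (h : ℝ → ℝ) : ℝ :=
  lam * ∫ r, ballVol d r * h r ∂F

/-- Covariance function of the thinned grain cover. -/
def kth (d : ℕ) (lam : ℝ) (F : Measure ℝ) (h : ℝ → ℝ) (q : ℝ → ℝ → ℝ → ℝ)
    (z : Euc d) : ℝ :=
  lam * ∫ r, interVol d 0 r z r * h r ∂F +
    lam ^ 2 * ∫ r₁, (∫ r₂, (∫ x, interVol d 0 r₁ x r₂ * q (‖x - z‖) r₁ r₂) ∂F) ∂F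

/-- Two-point correlation function of the thinned grain centers. -/
def xith (d : ℕ) (lam : ℝ) (F : Measure ℝ) (h : ℝ → ℝ) (q : ℝ → ℝ → ℝ → ℝ)
    (z : Euc d) : ℝ :=
  (lam / lamth lam F h) ^ 2 * ∫ r₁, (∫ r₂, q ‖z‖ r₁ r₂ ∂F) ∂F


structure RV (F : Measure ℝ) (α : ℝ) : Prop where
  pos : ∀ t > 0, 0 < tailF F t
  ratio : ∀ a > 0, Tendsto (fun t => tailF F (a * t) / tailF F t) atTop (nhds (a ^ (-α)))

theorem rv_of {F : Measure ℝ} {α : ℝ} {ℓ : ℝ → ℝ} (hℓ : SlowlyVarying ℓ)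
    (htail : ∀ x > 0, tailF F x = ℓ x * x ^ (-α)) : RV F α := by
  obtain ⟨_, hp, hr⟩ := hℓ
  refine ⟨fun t ht => ?_, fun a ha => ?_⟩
  · rw [htail t ht]
    have := hp t ht
    positivity
  · have h1 := (hr a ha).mul_const (a ^ (-α))
    rw [one_mul] at h1
    refine h1.congr' ?_
    filter_upwards [eventually_gt_atTop 0] with t ht
    rw [htail t ht, htail _ (mul_pos ha ht), Real.mul_rpow ha.le ht.le]
    have := hp t ht
    have h2 : 0 < t ^ (-α) := by positivity
    field_simp

theorem tailF_anti (F : Measure ℝ) [IsProbabilityMeasure F] : Antitone (tailF F) := by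
  intro a b hab
  exact measureReal_mono (Ioi_subset_Ioi hab)

theorem tailF_nonneg (F : Measure ℝ) (t : ℝ) : 0 ≤ tailF F t := ENNReal.toReal_nonneg

/-- closed tail -/
def tailC (F : Measure ℝ) (x : ℝ) : ℝ := (F (Ici x)).toReal

theorem tailC_nonneg (F : Measure ℝ) (t : ℝ) : 0 ≤ tailC F t := ENNReal.toReal_nonneg

theorem tailF_le_tailC (F : Measure ℝ) [IsProbabilityMeasure F] (t : ℝ) :
    tailF F t ≤ tailC F t := measureReal_mono Ioi_subset_Ici_self

theorem tailC_le_tailF (F : Measure ℝ) [IsProbabilityMeasure F] {s t : ℝ} (h : s < t) :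
    tailC F t ≤ tailF F s := measureReal_mono (fun _ hx => lt_of_lt_of_le h hx)

theorem tailC_anti (F : Measure ℝ) [IsProbabilityMeasure F] : Antitone (tailC F) := by
  intro a b hab
  exact measureReal_mono (Ici_subset_Ici.2 hab)

theorem rv_potter {F : Measure ℝ} [IsProbabilityMeasure F] {α β : ℝ} (h : RV F α)
    (hβ : β < α) (hβ0 : 0 ≤ β) :
    ∃ C > 0, ∃ t0 > 0, ∀ t ≥ t0, ∀ w ≥ 1, tailF F (w * t) ≤ C * w ^ (-β) * tailF F t := by
  have h2 := h.ratio 2 (by norm_num)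
  have hlt : (2:ℝ) ^ (-α) < 2 ^ (-β) :=
    Real.rpow_lt_rpow_of_exponent_lt (by norm_num) (by linarith)
  obtain ⟨t1, ht1⟩ := eventually_atTop.1 (h2.eventually_lt_const hlt)
  refine ⟨2 ^ β, by positivity, max t1 1, by positivity, fun t ht w hw => ?_⟩
  have ht1' : t1 ≤ t := le_trans (le_max_left _ _) ht
  have ht0 : 1 ≤ t := le_trans (le_max_right _ _) ht
  have step : ∀ n : ℕ, tailF F (2 ^ n * t) ≤ ((2:ℝ) ^ (-β)) ^ n * tailF F t := by
    intro n
    induction n with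
    | zero => simp
    | succ n ih =>
      have hn : (1:ℝ) ≤ 2 ^ n := one_le_pow₀ (by norm_num)
      have hge : t ≤ 2 ^ n * t := le_mul_of_one_le_left (by linarith) hn
      have := ht1 (2 ^ n * t) (ht1'.trans hge)
      rw [div_lt_iff₀ (h.pos _ (by linarith))] at this
      calc tailF F (2 ^ (n+1) * t) = tailF F (2 * (2 ^ n * t)) := by ring_nf
        _ ≤ 2 ^ (-β) * tailF F (2 ^ n * t) := this.le
        _ ≤ 2 ^ (-β) * (((2:ℝ) ^ (-β)) ^ n * tailF F t) := by gcongr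
        _ = _ := by ring
  obtain ⟨n, hn1, hn2⟩ := exists_nat_pow_near hw (by norm_num : (1:ℝ) < 2)
  have hw0 : 0 < w := by linarith
  calc tailF F (w * t) ≤ tailF F (2 ^ n * t) := tailF_anti F (by gcongr)
    _ ≤ ((2:ℝ) ^ (-β)) ^ n * tailF F t := step n
    _ ≤ _ := by
      gcongr
      · exact tailF_nonneg _ _
      have e1 : ((2:ℝ) ^ (-β)) ^ n = 2 ^ β * ((2:ℝ) ^ (n+1)) ^ (-β) := by
        rw [← Real.rpow_natCast, ← Real.rpow_natCast, ← Real.rpow_mul (by norm_num),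
          ← Real.rpow_mul (by norm_num), ← Real.rpow_add (by norm_num)]
        congr 1; push_cast; ring
      rw [e1]
      exact mul_le_mul_of_nonneg_left
        (Real.rpow_le_rpow_of_nonpos hw0 hn2.le (by linarith)) (by positivity)

theorem rv_tendsto {F : Measure ℝ} [IsProbabilityMeasure F] {α : ℝ} (h : RV F α)
    {ι : Type*} {L : Filter ι} {τ : ι → ℝ} (hτ : Tendsto τ L atTop)
    {n : ι → ℝ} {n0 : ℝ} (hn0 : 0 < n0) (hn : Tendsto n L (nhds n0)) :
    Tendsto (fun i => tailF F (τ i * n i) / tailF F (τ i)) L (nhds (n0 ^ (-α))) ∧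
    Tendsto (fun i => tailC F (τ i * n i) / tailF F (τ i)) L (nhds (n0 ^ (-α))) := by
  have hcont : ContinuousAt (fun x : ℝ => x ^ (-α)) n0 :=
    Real.continuousAt_rpow_const _ _ (Or.inl hn0.ne')
  have key : ∀ c, c < n0 ^ (-α) → ∀ᶠ i in L, c < tailF F (τ i * n i) / tailF F (τ i) := by
    intro c hc
    have := ((hcont.tendsto.eventually_const_lt hc).and (lt_mem_nhds hn0))
    have h3 := (this.filter_mono (nhdsWithin_le_nhds (s := Ioi n0))).and self_mem_nhdsWithin
    obtain ⟨b, ⟨hb1, hb2⟩, hb3⟩ := h3.exists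
    have hb3 : n0 < b := hb3
    filter_upwards [((h.ratio b hb2).comp hτ).eventually_const_lt hb1, hn.eventually_lt_const hb3,
      hτ.eventually_gt_atTop 0] with i h1 h2 h3
    refine h1.trans_le ?_
    have := h.pos _ h3
    simp only [Function.comp]
    gcongr
    apply tailF_anti
    rw [mul_comm]; gcongr
  have key2 : ∀ c, n0 ^ (-α) < c → ∀ᶠ i in L, tailC F (τ i * n i) / tailF F (τ i) < c := by
    intro c hc
    have := ((hcont.tendsto.eventually_lt_const hc).and (lt_mem_nhds hn0))
    have h3 := (this.filter_mono (nhdsWithin_le_nhds (s := Iio n0))).and self_mem_nhdsWithin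
    obtain ⟨b, ⟨hb1, hb2⟩, hb3⟩ := h3.exists
    have hb3 : b < n0 := hb3
    filter_upwards [((h.ratio b hb2).comp hτ).eventually_lt_const hb1, hn.eventually_const_lt hb3,
      hτ.eventually_gt_atTop 0] with i h1 h2 h3
    refine lt_of_le_of_lt ?_ h1
    have := h.pos _ h3
    simp only [Function.comp]
    gcongr
    apply tailC_le_tailF
    rw [mul_comm]; gcongr
  have cmp : ∀ᶠ i in L, tailF F (τ i * n i) / tailF F (τ i) ≤ tailC F (τ i * n i) / tailF F (τ i) := by
    refine Eventually.of_forall fun i => ?_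
    have := tailF_nonneg F (τ i)
    gcongr
    exact tailF_le_tailC _ _
  constructor
  · refine tendsto_order.2 ⟨key, fun c hc => ?_⟩
    filter_upwards [key2 c hc, cmp] with i h1 h2 using h2.trans_lt h1
  · refine tendsto_order.2 ⟨fun c hc => ?_, key2⟩
    filter_upwards [key c hc, cmp] with i h1 h2 using h1.trans_le h2

theorem lemG {d : ℕ} {F : Measure ℝ} [IsProbabilityMeasure F] {α : ℝ} (h : RV F α)
    (hα : (d : ℝ) < α) (n : ℝ → Euc d → ℝ) (n0 : Euc d → ℝ)
    (hmeas : ∀ t, Measurable (n t)) (hpos : ∀ y, 0 < n0 y)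
    (hlim : ∀ y, Tendsto (fun t => n t y) atTop (nhds (n0 y)))
    (δ : ℝ) (hδ : 0 < δ) (hdom : ∀ᶠ t in atTop, ∀ y, δ * (1 + ‖y‖) ≤ n t y) :
    Tendsto (fun t => (∫ y, tailC F (t * n t y)) / tailF F t) atTop
      (nhds (∫ y, (n0 y) ^ (-α))) ∧ Integrable (fun y => (n0 y) ^ (-α)) := by
  obtain ⟨β, hβ1, hβ2⟩ := exists_between hα
  have hd0 : (0:ℝ) ≤ d := Nat.cast_nonneg d
  obtain ⟨C, hC, t0, ht0, hP⟩ := rv_potter h hβ2 (hd0.trans hβ1.le)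
  have hδ2 : 0 < δ / 2 := by linarith
  have hr := h.ratio (δ/2) hδ2
  obtain ⟨K, hK⟩ : ∃ K, ∀ᶠ t in atTop, tailF F (δ/2 * t) / tailF F t ≤ K :=
    ⟨_, (hr.eventually_lt_const (lt_add_one _)).mono fun _ h => h.le⟩
  have hIg : Integrable (fun y : Euc d => C * K * (1 + ‖y‖) ^ (-β)) := by
    apply Integrable.const_mul
    apply integrable_one_add_norm
    simpa using hβ1
  have hbd : ∀ᶠ t in atTop, ∀ y, tailC F (t * n t y) / tailF F t ≤ C * K * (1 + ‖y‖) ^ (-β) := by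
    filter_upwards [hK, hdom, eventually_gt_atTop 0, eventually_ge_atTop (t0 / (δ/2))]
      with t h1 h2 h3 h4 y
    have h5 : t0 ≤ δ/2 * t := by
      rw [div_le_iff₀ hδ2] at h4; linarith
    have h6 : (1:ℝ) ≤ 1 + ‖y‖ := by linarith [norm_nonneg y]
    have hp := h.pos t h3
    calc tailC F (t * n t y) / tailF F t ≤ tailF F ((1 + ‖y‖) * (δ/2 * t)) / tailF F t := by
          gcongr
          apply tailC_le_tailF
          have := h2 y
          nlinarith [mul_le_mul_of_nonneg_left this h3.le, mul_pos (mul_pos hδ h3) (lt_of_lt_of_le one_pos h6)]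
      _ ≤ (C * (1 + ‖y‖) ^ (-β) * tailF F (δ/2 * t)) / tailF F t := by
          gcongr
          exact hP _ h5 _ h6
      _ = C * (1 + ‖y‖) ^ (-β) * (tailF F (δ/2 * t) / tailF F t) := by ring
      _ ≤ C * (1 + ‖y‖) ^ (-β) * K := by gcongr
      _ = _ := by ring
  have hpt : ∀ y, Tendsto (fun t => tailC F (t * n t y) / tailF F t) atTop (nhds (n0 y ^ (-α))) :=
    fun y => (rv_tendsto h tendsto_id (hpos y) (hlim y)).2
  have hmeas' : ∀ t, Measurable (fun y => tailC F (t * n t y) / tailF F t) := fun t =>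
    ((tailC_anti F).measurable.comp ((hmeas t).const_mul t)).div_const _
  have hnn : ∀ t y, 0 ≤ tailC F (t * n t y) / tailF F t := fun t y =>
    div_nonneg (tailC_nonneg _ _) (tailF_nonneg _ _)
  constructor
  · have := tendsto_integral_filter_of_dominated_convergence (μ := (volume : Measure (Euc d)))
      (F := fun t y => tailC F (t * n t y) / tailF F t) (l := atTop)
      (f := fun y => n0 y ^ (-α)) _
      (Eventually.of_forall fun t => (hmeas' t).aestronglyMeasurable)
      (hbd.mono fun t ht => Eventually.of_forall fun y => by
        rw [Real.norm_of_nonneg (hnn t y)]; exact ht y) hIg (Eventually.of_forall hpt)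
    simpa only [integral_div] using this
  · have hm0 : Measurable n0 := measurable_of_tendsto_metrizable' atTop hmeas
      (tendsto_pi_nhds.2 hlim)
    refine hIg.mono' (hm0.pow_const _).aestronglyMeasurable (Eventually.of_forall fun y => ?_)
    rw [Real.norm_of_nonneg (Real.rpow_nonneg (hpos y).le _)]
    exact le_of_tendsto (hpt y) (hbd.mono fun t ht => ht y)

theorem ballVol_eq (d : ℕ) {r : ℝ} (hr : 0 ≤ r) : ballVol d r = r ^ d * ballVol d 1 := by
  unfold ballVol
  rw [Measure.addHaar_closedBall' _ _ hr, ENNReal.toReal_mul, ENNReal.toReal_ofReal (by positivity)]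
  simp

theorem ballVol_nonneg (d : ℕ) (r : ℝ) : 0 ≤ ballVol d r := ENNReal.toReal_nonneg

theorem ballVol_neg (d : ℕ) {r : ℝ} (hr : r < 0) : ballVol d r = 0 := by
  unfold ballVol
  rw [closedBall_eq_empty.2 hr]; simp

theorem ballVol_mono (d : ℕ) : Monotone (ballVol d) := by
  intro a b hab
  exact measureReal_mono (closedBall_subset_closedBall hab) measure_closedBall_lt_top.ne

theorem ballVol_le (d : ℕ) (r : ℝ) : ballVol d r ≤ |r| ^ d * ballVol d 1 := by
  rw [← ballVol_eq d (abs_nonneg r)]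
  exact ballVol_mono d (le_abs_self r)

theorem ballVol_one_pos (d : ℕ) : 0 < ballVol d 1 := by
  unfold ballVol
  exact ENNReal.toReal_pos (measure_closedBall_pos _ _ one_pos).ne' measure_closedBall_lt_top.ne

theorem ballVol_two_mul (d : ℕ) (r : ℝ) : ballVol d (2 * r) = 2 ^ d * ballVol d r := by
  rcases le_or_gt 0 r with h | h
  · rw [ballVol_eq d h, ballVol_eq d (by positivity : 0 ≤ 2 * r), mul_pow]; ring
  · rw [ballVol_neg d h, ballVol_neg d (by linarith : 2 * r < 0)]; simp

theorem interVol_nonneg (d : ℕ) (x : Euc d) (r : ℝ) (y : Euc d) (s : ℝ) :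
    0 ≤ interVol d x r y s := ENNReal.toReal_nonneg

theorem inter_ne_top {d : ℕ} (x : Euc d) (r : ℝ) (y : Euc d) (s : ℝ) :
    volume (closedBall x r ∩ closedBall y s) ≠ ⊤ :=
  ((measure_mono inter_subset_left).trans_lt measure_closedBall_lt_top).ne

theorem interVol_le (d : ℕ) (r : ℝ) (y : Euc d) (s : ℝ) :
    interVol d 0 r y s ≤ ballVol d r :=
  measureReal_mono inter_subset_left measure_closedBall_lt_top.ne

theorem interVol_mono (d : ℕ) (x : Euc d) {r r' : ℝ} (y : Euc d) {s s' : ℝ} (h : r ≤ r')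
    (h' : s ≤ s') : interVol d x r y s ≤ interVol d x r' y s' :=
  measureReal_mono (inter_subset_inter (closedBall_subset_closedBall h)
    (closedBall_subset_closedBall h')) (inter_ne_top _ _ _ _)

theorem interVol_zero (d : ℕ) {r : ℝ} {y : Euc d} {s : ℝ} (h : r + s < ‖y‖) :
    interVol d 0 r y s = 0 := by
  unfold interVol
  have : closedBall (0 : Euc d) r ∩ closedBall y s = ∅ := by
    ext x
    simp only [mem_inter_iff, mem_closedBall, dist_eq_norm, mem_empty_iff_false, iff_false, not_and,
      sub_zero]
    intro h1 h2
    have := norm_sub_le x (x - y)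
    simp at this
    linarith
  rw [this]; simp

theorem interVol_full (d : ℕ) {r : ℝ} {y : Euc d} {s : ℝ} (h : ‖y‖ ≤ s - r) :
    interVol d 0 r y s = ballVol d r := by
  unfold interVol ballVol
  rw [inter_eq_left.2]
  intro x hx
  simp only [mem_closedBall, dist_eq_norm, sub_zero] at *
  linarith [norm_sub_le x y]

theorem interVol_symm (d : ℕ) (r : ℝ) (y : Euc d) (s : ℝ) :
    interVol d 0 r y s = interVol d 0 s y r := by
  unfold interVol
  congr 1
  have := (Measure.measurePreserving_sub_left (volume : Measure (Euc d)) y).measure_preimage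
    (s := closedBall 0 s ∩ closedBall y r)
    (measurableSet_closedBall.inter measurableSet_closedBall).nullMeasurableSet
  rw [← this]
  congr 1
  ext x
  simp only [mem_inter_iff, mem_closedBall, dist_eq_norm, mem_preimage, sub_zero]
  rw [norm_sub_rev y x, and_comm]
  simp

theorem norm_e1 {d : ℕ} (hd : 0 < d) : ‖e1 d‖ = 1 := by
  simp [e1, hd]

theorem interVol_rot {d : ℕ} (r : ℝ) {y z : Euc d} (s : ℝ) (h : ‖y‖ = ‖z‖) :
    interVol d 0 r y s = interVol d 0 r z s := by
  unfold interVol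
  congr 1
  let T := (Submodule.span ℝ {y - z})ᗮ.reflection
  have hT : T y = z := Submodule.reflection_sub h
  have := T.measurePreserving.measure_preimage
    (s := closedBall 0 r ∩ closedBall z s)
    (measurableSet_closedBall.inter measurableSet_closedBall).nullMeasurableSet
  rw [← this]
  congr 1
  ext x
  simp only [mem_inter_iff, mem_closedBall, mem_preimage, ← hT, T.dist_map, dist_zero_right,
    T.norm_map]

theorem interVol_norm {d : ℕ} (hd : 0 < d) (r : ℝ) (z : Euc d) (s : ℝ) :
    interVol d 0 r z s = interVol d 0 r (‖z‖ • e1 d) s :=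
  interVol_rot r s (by rw [norm_smul, norm_e1 hd]; simp)

/-- joint measurability -/
theorem measurable_interVol {β : Type*} [MeasurableSpace β] {d : ℕ} {r : β → ℝ} {x : β → Euc d} {s : β → ℝ}
    (hr : Measurable r) (hx : Measurable x) (hs : Measurable s) :
    Measurable (fun b => interVol d 0 (r b) (x b) (s b)) := by
  unfold interVol
  apply Measurable.ennreal_toReal
  have hS : MeasurableSet {p : β × Euc d | ‖p.2‖ ≤ r p.1 ∧ ‖p.2 - x p.1‖ ≤ s p.1} := by
    apply MeasurableSet.inter
    · exact measurableSet_le (f := fun p : β × Euc d => ‖p.2‖) (g := fun p => r p.1)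
        (by fun_prop) (by fun_prop)
    · exact measurableSet_le (f := fun p : β × Euc d => ‖p.2 - x p.1‖) (g := fun p => s p.1)
        (by fun_prop) (by fun_prop)
  convert measurable_measure_prodMk_left (ν := (volume : Measure (Euc d))) hS using 3 with b
  ext y
  simp [dist_eq_norm]

theorem integrable_ballVol {d : ℕ} {F : Measure ℝ} [IsProbabilityMeasure F]
    (hmom : Integrable (fun r : ℝ => r ^ d) F) (a : ℝ) :
    Integrable (fun s => ballVol d (s + a)) F := by
  have h1 : Integrable (fun s : ℝ => 2 ^ (d - 1) * (|s| ^ d + |a| ^ d) * ballVol d 1) F := by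
    apply Integrable.mul_const
    apply Integrable.const_mul
    apply Integrable.add _ (integrable_const _)
    simpa [abs_pow] using hmom.abs
  refine h1.mono' ((ballVol_mono d).measurable.comp (by fun_prop)).aestronglyMeasurable
    (Eventually.of_forall fun s => ?_)
  rw [Real.norm_of_nonneg (ballVol_nonneg _ _)]
  refine (ballVol_le d _).trans ?_
  gcongr
  · exact (ballVol_one_pos d).le
  refine le_trans ?_ (add_pow_le (abs_nonneg s) (abs_nonneg a) d)
  gcongr
  exact abs_add_le s a

theorem integrable_interVol {d : ℕ} {F : Measure ℝ} [IsProbabilityMeasure F]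
    (hmom : Integrable (fun r : ℝ => r ^ d) F) (a : ℝ) (z : Euc d) (b : ℝ) :
    Integrable (fun s => interVol d 0 (s + a) z (s + b)) F := by
  refine (integrable_ballVol hmom a).mono'
    (measurable_interVol (by fun_prop) (by fun_prop) (by fun_prop)).aestronglyMeasurable
    (Eventually.of_forall fun s => ?_)
  rw [Real.norm_of_nonneg (interVol_nonneg _ _ _ _ _)]
  exact interVol_le _ _ _ _

theorem fubini_layer {d : ℕ} (μ : Measure ℝ) [SFinite μ] (m : Euc d → ℝ) (hm : Measurable m)
    (f : ℝ → ENNReal) (hf : Measurable f) :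
    ∫⁻ s, volume {y | m y ≤ s} * f s ∂μ = ∫⁻ y, ∫⁻ s in Ici (m y), f s ∂μ := by
  have hS : MeasurableSet {p : ℝ × Euc d | m p.2 ≤ p.1} :=
    measurableSet_le (by fun_prop) (by fun_prop)
  have h1 : ∀ s, volume {y | m y ≤ s} * f s
      = ∫⁻ y, {p : ℝ × Euc d | m p.2 ≤ p.1}.indicator (fun p => f p.1) (s, y) := by
    intro s
    have : MeasurableSet {y | m y ≤ s} := measurableSet_le hm measurable_const
    rw [mul_comm, ← lintegral_indicator_const this]
    rfl
  simp_rw [h1]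
  rw [lintegral_lintegral_swap]
  · congr with y
    rw [← lintegral_indicator measurableSet_Ici]
    rfl
  · exact ((hf.comp measurable_fst).indicator hS).aemeasurable

theorem fubini_F {d : ℕ} (F : Measure ℝ) [IsProbabilityMeasure F] (m : Euc d → ℝ)
    (hm : Measurable m) (hfin : ∀ s, volume {y | m y ≤ s} ≠ ⊤) :
    ∫ s, (volume {y | m y ≤ s}).toReal ∂F = ∫ y, tailC F (m y) := by
  have hmono : Monotone (fun s => volume {y | m y ≤ s}) := fun a b hab =>
    measure_mono fun y hy => le_trans hy hab
  have hanti : Antitone (fun x => F (Ici x)) := fun a b hab => measure_mono (Ici_subset_Ici.2 hab)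
  unfold tailC
  rw [integral_toReal hmono.measurable.aemeasurable (Eventually.of_forall fun s => (hfin s).lt_top),
    integral_toReal (f := fun y => F (Ici (m y))) (hanti.measurable.comp hm).aemeasurable
      (Eventually.of_forall fun s => measure_lt_top _ _)]
  congr 1
  have := fubini_layer F m hm (fun _ => 1) measurable_const
  simpa using this

def mfun (d : ℕ) (z : Euc d) (y : Euc d) : ℝ := max ‖y‖ ‖y - z‖

theorem mfun_meas (d : ℕ) (z : Euc d) : Measurable (mfun d z) := by
  unfold mfun; fun_prop

theorem mfun_set (d : ℕ) (z : Euc d) (s : ℝ) :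
    {y | mfun d z y ≤ s} = closedBall 0 s ∩ closedBall z s := by
  ext y; simp [mfun, dist_eq_norm]

theorem mfun_ge {d : ℕ} (hd : 0 < d) (y : Euc d) : (1/4) * (1 + ‖y‖) ≤ mfun d (e1 d) y := by
  have h1 := norm_sub_le y (y - e1 d)
  rw [sub_sub_cancel, norm_e1 hd] at h1
  have h2 : ‖y‖ ≤ mfun d (e1 d) y := le_max_left _ _
  have h3 : ‖y - e1 d‖ ≤ mfun d (e1 d) y := le_max_right _ _
  linarith

theorem cconst_eq {d : ℕ} (hd : 0 < d) {α : ℝ} (hα : (d : ℝ) < α) :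
    cconst d α = ∫ y, (mfun d (e1 d) y) ^ (-α) := by
  have hα0 : 0 < α := lt_of_le_of_lt (Nat.cast_nonneg d) hα
  have hpos : ∀ y, 0 < mfun d (e1 d) y := fun y =>
    lt_of_lt_of_le (by have := norm_nonneg y; positivity) (mfun_ge hd y)
  have hmf : Measurable (fun s : ℝ => ENNReal.ofReal (α * s ^ (-α - 1))) := by fun_prop
  have key := fubini_layer (volume.restrict (Ioi 0)) (mfun d (e1 d)) (mfun_meas _ _) _ hmf
  have hinner : ∀ y, ∫⁻ s in Ici (mfun d (e1 d) y), ENNReal.ofReal (α * s ^ (-α - 1)) ∂(volume.restrict (Ioi 0))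
      = ENNReal.ofReal (mfun d (e1 d) y ^ (-α)) := by
    intro y
    rw [Measure.restrict_restrict measurableSet_Ici, inter_eq_left.2 (Ici_subset_Ioi.2 (hpos y)),
      setLIntegral_congr Ioi_ae_eq_Ici.symm, ← ofReal_integral_eq_lintegral_ofReal]
    · rw [integral_const_mul, integral_Ioi_rpow_of_lt (by linarith) (hpos y)]
      congr 1
      rw [show -α - 1 + 1 = -α by ring]
      field_simp
    · exact (integrableOn_Ioi_rpow_of_lt (by linarith) (hpos y)).const_mul _
    · filter_upwards [ae_restrict_mem measurableSet_Ioi] with s hs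
      have : 0 < s := (hpos y).trans hs
      positivity
  simp_rw [hinner] at key
  unfold cconst
  rw [integral_eq_lintegral_of_nonneg_ae (Eventually.of_forall fun y => Real.rpow_nonneg (hpos y).le _)
    ((mfun_meas _ _).pow_const _).aestronglyMeasurable, ← key,
    integral_eq_lintegral_of_nonneg_ae]
  · congr 1
    refine setLIntegral_congr_fun measurableSet_Ioi fun s hs => ?_
    have hs : 0 < s := hs
    rw [mfun_set, ENNReal.ofReal_mul (interVol_nonneg _ _ _ _ _)]
    congr 1
    exact ENNReal.ofReal_toReal (inter_ne_top _ _ _ _)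
  · filter_upwards [ae_restrict_mem measurableSet_Ioi] with s hs
    have hs : 0 < s := hs
    have := interVol_nonneg d 0 s (e1 d) s
    show 0 ≤ _
    positivity
  · apply Measurable.aestronglyMeasurable
    exact (measurable_interVol measurable_id measurable_const measurable_id).mul (by fun_prop)

def Dn (d : ℕ) (F : Measure ℝ) (t : ℝ) : ℝ := t ^ d * tailF F t

theorem Dn_pos (d : ℕ) {F : Measure ℝ} {α : ℝ} (h : RV F α) {t : ℝ} (ht : 0 < t) : 0 < Dn d F t :=
  mul_pos (by positivity) (h.pos t ht)

/-- scaling -/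
theorem scale_int {d : ℕ} (f : Euc d → ℝ) {t : ℝ} (ht : 0 < t) :
    ∫ y, f y = t ^ d * ∫ y, f (t • y) := by
  rw [Measure.integral_comp_smul]
  simp only [finrank_euclideanSpace, Fintype.card_fin, smul_eq_mul]
  rw [abs_of_pos (by positivity), ← mul_assoc, mul_inv_cancel₀ (by positivity), one_mul]

theorem Jlem {d : ℕ} (hd : 0 < d) {F : Measure ℝ} [IsProbabilityMeasure F] {α : ℝ} (h : RV F α)
    (hα : (d : ℝ) < α) (a : ℝ) :
    Tendsto (fun t => (∫ s, interVol d 0 (s + a) (t • e1 d) (s + a) ∂F) / Dn d F t) atTop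
      (nhds (cconst d α)) := by
  have hG := (lemG h hα (fun t y => mfun d (e1 d) y - a / t) (mfun d (e1 d))
    (fun t => (mfun_meas _ _).sub_const _)
    (fun y => lt_of_lt_of_le (by have := norm_nonneg y; positivity) (mfun_ge hd y))
    (fun y => by
      have : Tendsto (fun t : ℝ => a / t) atTop (nhds 0) := tendsto_const_nhds.div_atTop tendsto_id
      simpa using this.const_sub (mfun d (e1 d) y))
    (1/8) (by norm_num) (by
      have : Tendsto (fun t : ℝ => a / t) atTop (nhds 0) := tendsto_const_nhds.div_atTop tendsto_id
      filter_upwards [this.eventually_lt_const (by norm_num : (0:ℝ) < 1/8)] with t ht y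
      have := mfun_ge hd y
      have := norm_nonneg y
      linarith)).1
  rw [cconst_eq hd hα]
  refine hG.congr' ?_
  filter_upwards [eventually_gt_atTop 0] with t ht
  have hp := h.pos t ht
  have e : ∫ s, interVol d 0 (s + a) (t • e1 d) (s + a) ∂F
      = ∫ y, tailC F (mfun d (t • e1 d) y - a) := by
    have hset : ∀ s, {y | mfun d (t • e1 d) y - a ≤ s} = closedBall 0 (s+a) ∩ closedBall (t • e1 d) (s+a) := by
      intro s
      rw [← mfun_set]; ext y; simp
    have := fubini_F F (fun y => mfun d (t • e1 d) y - a) ((mfun_meas _ _).sub_const _)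
      (fun s => by rw [hset]; exact inter_ne_top _ _ _ _)
    simp only [hset] at this
    exact this
  rw [e, scale_int (fun y => tailC F (mfun d (t • e1 d) y - a)) ht]
  have e2 : ∀ y, mfun d (t • e1 d) (t • y) - a = t * (mfun d (e1 d) y - a / t) := by
    intro y
    unfold mfun
    rw [← smul_sub, norm_smul, norm_smul, Real.norm_of_nonneg ht.le, ← mul_max_of_nonneg _ _ ht.le]
    field_simp
  have e3 : ∫ y, tailC F (mfun d (t • e1 d) (t • y) - a)
      = ∫ y, tailC F (t * (mfun d (e1 d) y - a / t)) := by
    congr with y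
    rw [e2]
  simp only [e3]
  unfold Dn
  field_simp

theorem cconst_pos {d : ℕ} (hd : 0 < d) {F : Measure ℝ} [IsProbabilityMeasure F] {α : ℝ} (h : RV F α)
    (hα : (d : ℝ) < α) : 0 < cconst d α := by
  have hpos : ∀ y, 0 < mfun d (e1 d) y := fun y =>
    lt_of_lt_of_le (by have := norm_nonneg y; positivity) (mfun_ge hd y)
  have hG := (lemG h hα (fun t y => mfun d (e1 d) y) (mfun d (e1 d))
    (fun t => mfun_meas _ _) hpos
    (fun y => tendsto_const_nhds) (1/4) (by norm_num)
    (Eventually.of_forall fun t y => mfun_ge hd y)).2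
  rw [cconst_eq hd hα, integral_pos_iff_support_of_nonneg
    (fun y => Real.rpow_nonneg (hpos y).le _) hG]
  have : Function.support (fun y => mfun d (e1 d) y ^ (-α)) = univ := by
    ext y
    simp only [Function.mem_support, mem_univ, iff_true]
    exact (Real.rpow_pos_of_pos (hpos y) _).ne'
  rw [this]
  exact Measure.measure_univ_pos.2 (NeZero.ne _)

def Tt (d : ℕ) (F : Measure ℝ) (v : ℝ) : ℝ := ∫ s in Ici v, ballVol d s ∂F

theorem Tt_bound {d : ℕ} {F : Measure ℝ} [IsProbabilityMeasure F] {α : ℝ} (h : RV F α)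
    (hα : (d : ℝ) < α) : ∃ C > 0, ∀ᶠ t in atTop, Tt d F (t / 6) ≤ C * Dn d F t := by
  have hG := (lemG h hα (fun t (y : Euc d) => max ‖y‖ (1/6)) (fun y => max ‖y‖ (1/6))
    (fun t => by fun_prop) (fun y => lt_of_lt_of_le (by norm_num) (le_max_right _ _))
    (fun y => tendsto_const_nhds) (1/12) (by norm_num)
    (Eventually.of_forall fun t y => by
      have h1 := le_max_left ‖y‖ (1/6)
      have h2 := le_max_right ‖y‖ (1/6)
      linarith)).1
  have hnn : 0 ≤ ∫ y : Euc d, (max ‖y‖ (1/6)) ^ (-α) :=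
    integral_nonneg fun y => Real.rpow_nonneg (le_trans (by norm_num) (le_max_right _ _)) _
  refine ⟨_, add_pos_of_nonneg_of_pos hnn one_pos, ?_⟩
  filter_upwards [hG.eventually_lt_const (lt_add_one _), eventually_gt_atTop 0] with t h1 ht
  rw [div_lt_iff₀ (h.pos t ht)] at h1
  have hset : ∀ s, {y : Euc d | max ‖y‖ (t/6) ≤ s} = if t / 6 ≤ s then closedBall 0 s else ∅ := by
    intro s
    split_ifs with hs
    · ext y; simp [hs]
    · ext y; simp [hs]
  have e : Tt d F (t/6) = ∫ y : Euc d, tailC F (max ‖y‖ (t/6)) := by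
    rw [← fubini_F F _ (by fun_prop)]
    · simp_rw [hset]
      unfold Tt
      rw [← integral_indicator measurableSet_Ici]
      congr with s
      by_cases hs : t / 6 ≤ s
      · simp [hs, ballVol]
      · simp [hs]
    · intro s
      rw [hset]
      split_ifs
      · exact measure_closedBall_lt_top.ne
      · simp
  rw [e, scale_int _ ht]
  have e2 : ∀ y : Euc d, max ‖t • y‖ (t/6) = t * max ‖y‖ (1/6) := by
    intro y
    rw [norm_smul, Real.norm_of_nonneg ht.le, mul_max_of_nonneg _ _ ht.le]
    congr 1
    ring
  simp_rw [e2]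
  unfold Dn
  rw [← mul_assoc, mul_comm _ (t^d), mul_assoc]
  gcongr

theorem Jw {d : ℕ} (hd : 0 < d) {F : Measure ℝ} [IsProbabilityMeasure F] {α : ℝ} (h : RV F α)
    (hα : (d : ℝ) < α) (hmom : Integrable (fun r : ℝ => r ^ d) F) (a : ℝ) {w : ℝ → ℝ}
    (hwm : Measurable w) (hw : Tendsto w atTop (nhds 1)) :
    Tendsto (fun t => (∫ s, w s * interVol d 0 (s + a) (t • e1 d) (s + a) ∂F) / Dn d F t) atTop
      (nhds (cconst d α)) := by
  have hJ := Jlem hd h hα a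
  have hc := cconst_pos hd h hα
  set c := cconst d α
  have key : ∀ ε > 0, ∀ᶠ t in atTop,
      |(∫ s, w s * interVol d 0 (s + a) (t • e1 d) (s + a) ∂F) / Dn d F t -
        (∫ s, interVol d 0 (s + a) (t • e1 d) (s + a) ∂F) / Dn d F t| ≤ ε * (c + 1) := by
    intro ε hε
    obtain ⟨S, hS⟩ := eventually_atTop.1 ((Metric.tendsto_nhds.1 hw) ε hε)
    filter_upwards [eventually_gt_atTop (2 * (S + a)), eventually_gt_atTop 0,
      hJ.eventually_lt_const (lt_add_one c)] with t ht ht0 htJ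
    have hD := Dn_pos d h ht0
    have hI := integrable_interVol hmom a (t • e1 d) a
    have hpt : ∀ s, |w s - 1| * interVol d 0 (s + a) (t • e1 d) (s + a)
        ≤ ε * interVol d 0 (s + a) (t • e1 d) (s + a) := by
      intro s
      rcases lt_or_ge s S with hs | hs
      · rw [interVol_zero]
        · simp
        · rw [norm_smul, norm_e1 hd, Real.norm_of_nonneg ht0.le]; linarith
      · have := hS s hs
        rw [Real.dist_eq] at this
        exact mul_le_mul_of_nonneg_right this.le (interVol_nonneg _ _ _ _ _)
    have hI2 : Integrable (fun s => (w s - 1) * interVol d 0 (s + a) (t • e1 d) (s + a)) F := by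
      refine (hI.const_mul ε).mono' ((hwm.sub_const 1).aestronglyMeasurable.mul hI.1)
        (Eventually.of_forall fun s => ?_)
      rw [norm_mul, Real.norm_of_nonneg (interVol_nonneg _ _ _ _ _)]
      exact hpt s
    have e : ∫ s, w s * interVol d 0 (s + a) (t • e1 d) (s + a) ∂F =
        ∫ s, (w s - 1) * interVol d 0 (s + a) (t • e1 d) (s + a) ∂F +
        ∫ s, interVol d 0 (s + a) (t • e1 d) (s + a) ∂F := by
      rw [← integral_add hI2 hI]
      congr with s
      ring
    rw [e, ← sub_div, add_sub_cancel_right, abs_div, abs_of_pos hD]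
    calc _ ≤ (ε * ∫ s, interVol d 0 (s + a) (t • e1 d) (s + a) ∂F) / Dn d F t := by
          gcongr
          rw [← integral_const_mul]
          refine (abs_integral_le_integral_abs).trans ?_
          apply integral_mono hI2.abs (hI.const_mul ε)
          intro s
          simp only [abs_mul, abs_of_nonneg (interVol_nonneg d 0 (s+a) (t • e1 d) (s+a))]
          exact hpt s
      _ = ε * ((∫ s, interVol d 0 (s + a) (t • e1 d) (s + a) ∂F) / Dn d F t) := by ring
      _ ≤ _ := by gcongr
  have h0 : Tendsto (fun t => (∫ s, w s * interVol d 0 (s + a) (t • e1 d) (s + a) ∂F) / Dn d F t -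
        (∫ s, interVol d 0 (s + a) (t • e1 d) (s + a) ∂F) / Dn d F t) atTop (nhds 0) := by
    rw [Metric.tendsto_nhds]
    intro ε hε
    filter_upwards [key (ε / 2 / (c+1)) (by positivity)] with t ht
    rw [Real.dist_eq, sub_zero]
    rw [div_mul_cancel₀ _ (by positivity)] at ht
    linarith
  simpa using h0.add hJ

theorem Tt_nonneg (d : ℕ) (F : Measure ℝ) (v : ℝ) : 0 ≤ Tt d F v :=
  integral_nonneg fun _ => ballVol_nonneg _ _

theorem Tt_anti {d : ℕ} {F : Measure ℝ} [IsProbabilityMeasure F]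
    (hmom : Integrable (fun r : ℝ => r ^ d) F) : Antitone (Tt d F) := by
  intro a b hab
  have := integrable_ballVol hmom 0
  simp only [add_zero] at this
  exact setIntegral_mono_set this.integrableOn (Eventually.of_forall fun _ => ballVol_nonneg _ _)
    (Ici_subset_Ici.2 hab).eventuallyLE

theorem Tt_zero {d : ℕ} {F : Measure ℝ} [IsProbabilityMeasure F]
    (hmom : Integrable (fun r : ℝ => r ^ d) F) : Tendsto (Tt d F) atTop (nhds 0) := by
  have hi := integrable_ballVol hmom 0
  simp only [add_zero] at hi
  have := tendsto_integral_filter_of_dominated_convergence (μ := F) (l := atTop)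
    (F := fun v => (Ici v).indicator (ballVol d)) (f := fun _ => (0:ℝ)) (ballVol d)
    (Eventually.of_forall fun v =>
      ((ballVol_mono d).measurable.indicator measurableSet_Ici).aestronglyMeasurable)
    (Eventually.of_forall fun v => Eventually.of_forall fun s => by
      rw [Real.norm_of_nonneg (indicator_nonneg (fun _ _ => ballVol_nonneg _ _) _)]
      exact indicator_le_self' (fun _ _ => ballVol_nonneg _ _) _) hi
    (Eventually.of_forall fun s => by
      refine tendsto_const_nhds.congr' ?_
      filter_upwards [eventually_gt_atTop s] with v hv
      rw [indicator_of_notMem]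
      simpa using hv)
  simp only [integral_zero] at this
  refine this.congr fun v => ?_
  rw [integral_indicator measurableSet_Ici]; rfl

theorem hL_pos (d : ℕ) (lam : ℝ) (F : Measure ℝ) (r : ℝ) : 0 < hL d lam F r := Real.exp_pos _

theorem hL_le (d : ℕ) {lam : ℝ} (hlam : 0 < lam) (F : Measure ℝ) (r : ℝ) : hL d lam F r ≤ 1 := by
  unfold hL
  rw [Real.exp_le_one_iff]
  have : 0 ≤ ∫ s in Ici r, ballVol d (r + s) ∂F := integral_nonneg fun _ => ballVol_nonneg _ _
  nlinarith

theorem hL_meas (d : ℕ) (lam : ℝ) (F : Measure ℝ) [IsProbabilityMeasure F] :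
    Measurable (hL d lam F) := by
  unfold hL
  apply Real.measurable_exp.comp
  apply Measurable.neg
  apply Measurable.const_mul
  have : Measurable (fun p : ℝ × ℝ => {p : ℝ × ℝ | p.1 ≤ p.2}.indicator (fun p => ballVol d (p.1 + p.2)) p) := by
    apply Measurable.indicator
    · exact (ballVol_mono d).measurable.comp (by fun_prop)
    · exact measurableSet_le measurable_fst measurable_snd
  have h2 := (this.stronglyMeasurable.integral_prod_right' (ν := F)).measurable
  convert h2 using 2 with r
  rw [← integral_indicator measurableSet_Ici]
  rfl

theorem hL_tendsto {d : ℕ} (lam : ℝ) {F : Measure ℝ} [IsProbabilityMeasure F]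
    (hmom : Integrable (fun r : ℝ => r ^ d) F) : Tendsto (hL d lam F) atTop (nhds 1) := by
  have h0 : Tendsto (fun r => ∫ s in Ici r, ballVol d (r + s) ∂F) atTop (nhds 0) := by
    have h1 := (Tt_zero hmom).const_mul (2 ^ d)
    rw [mul_zero] at h1
    refine tendsto_of_tendsto_of_tendsto_of_le_of_le tendsto_const_nhds h1
      (fun r => integral_nonneg fun _ => ballVol_nonneg _ _) fun r => ?_
    have hi := integrable_ballVol hmom 0
    simp only [add_zero] at hi
    have hi2 := integrable_ballVol hmom r
    simp only [add_comm _ r] at hi2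
    simp only [Tt]
    rw [← integral_const_mul]
    refine setIntegral_mono_on hi2.integrableOn (hi.const_mul _).integrableOn measurableSet_Ici fun s hs => ?_
    rw [← ballVol_two_mul]
    apply ballVol_mono
    have : r ≤ s := hs
    linarith
  have h2 := (h0.const_mul lam).neg
  rw [mul_zero, neg_zero] at h2
  have := (Real.continuous_exp.tendsto 0).comp h2
  rw [Real.exp_zero] at this
  exact this

def Iv (d : ℕ) (F : Measure ℝ) (u r₁ r₂ : ℝ) : ℝ :=
  ∫ s in Ici (max r₁ r₂), interVol d 0 (r₁ + s) (u • e1 d) (r₂ + s) ∂F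

theorem Iv_nonneg (d : ℕ) (F : Measure ℝ) (u r₁ r₂ : ℝ) : 0 ≤ Iv d F u r₁ r₂ :=
  integral_nonneg fun _ => interVol_nonneg _ _ _ _ _

theorem Iv_meas {β : Type*} [MeasurableSpace β] (d : ℕ) (F : Measure ℝ) [IsProbabilityMeasure F]
    {u r₁ r₂ : β → ℝ} (hu : Measurable u) (h1 : Measurable r₁) (h2 : Measurable r₂) :
    Measurable (fun b => Iv d F (u b) (r₁ b) (r₂ b)) := by
  have : Measurable (fun p : β × ℝ => {p : β × ℝ | max (r₁ p.1) (r₂ p.1) ≤ p.2}.indicator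
      (fun p => interVol d 0 (r₁ p.1 + p.2) (u p.1 • e1 d) (r₂ p.1 + p.2)) p) := by
    apply Measurable.indicator
    · exact measurable_interVol (by fun_prop) (by fun_prop) (by fun_prop)
    · exact measurableSet_le (f := fun p : β × ℝ => max (r₁ p.1) (r₂ p.1)) (g := fun p => p.2)
        (by fun_prop) (by fun_prop)
  have h2 := (this.stronglyMeasurable.integral_prod_right' (ν := F)).measurable
  convert h2 using 2 with b
  unfold Iv
  rw [← integral_indicator measurableSet_Ici]
  rfl

theorem Iv_bound {d : ℕ} (hd : 0 < d) {F : Measure ℝ} [IsProbabilityMeasure F]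
    (hmom : Integrable (fun r : ℝ => r ^ d) F) {u r₁ r₂ v : ℝ}
    (hv : v ≤ max (max r₁ r₂) ((u - r₁ - r₂) / 2)) : Iv d F u r₁ r₂ ≤ 2 ^ d * Tt d F v := by
  have hi := integrable_ballVol hmom 0
  simp only [add_zero] at hi
  have hi2 := integrable_interVol hmom r₁ (u • e1 d) r₂
  simp only [add_comm _ r₁, add_comm _ r₂] at hi2
  unfold Iv Tt
  rw [← integral_const_mul, ← integral_indicator measurableSet_Ici, ← integral_indicator measurableSet_Ici]
  refine integral_mono (hi2.indicator measurableSet_Ici) ((hi.const_mul _).indicator measurableSet_Ici) fun s => ?_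
  simp only [indicator, mem_Ici]
  have hb := ballVol_nonneg d s
  split_ifs with h1 h2 h2
  · rw [← ballVol_two_mul]
    refine (interVol_le _ _ _ _).trans (ballVol_mono d ?_)
    linarith [le_max_left r₁ r₂]
  · rw [interVol_zero]
    rw [norm_smul, norm_e1 hd, mul_one]
    refine lt_of_lt_of_le ?_ (le_abs_self u)
    rcases le_max_iff.1 hv with h3 | h3 <;> linarith
  · positivity
  · exact le_rfl

theorem Iv_lim {d : ℕ} (hd : 0 < d) {F : Measure ℝ} [IsProbabilityMeasure F] {α : ℝ} (h : RV F α)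
    (hα : (d : ℝ) < α) (hmom : Integrable (fun r : ℝ => r ^ d) F) (r₁ r₂ : ℝ) :
    Tendsto (fun u => Iv d F u r₁ r₂ / Dn d F u) atTop (nhds (cconst d α)) := by
  set w : ℝ → ℝ := (Ici (max r₁ r₂)).indicator (fun _ => 1) with hw
  have hwm : Measurable w := measurable_const.indicator measurableSet_Ici
  have hwl : Tendsto w atTop (nhds 1) := by
    refine tendsto_const_nhds.congr' ?_
    filter_upwards [eventually_ge_atTop (max r₁ r₂)] with s hs
    rw [hw, indicator_of_mem]
    exact hs
  have hw0 : ∀ s, 0 ≤ w s := fun s => indicator_nonneg (fun _ _ => zero_le_one) _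
  have hw1 : ∀ s, w s ≤ 1 := fun s => indicator_le_self' (f := fun _ => (1:ℝ)) (fun _ _ => zero_le_one) s
  have hIg : ∀ u a b : ℝ, Integrable (fun s => w s * interVol d 0 (s + a) (u • e1 d) (s + b)) F := by
    intro u a b
    refine (integrable_interVol hmom a (u • e1 d) b).mono' (hwm.aestronglyMeasurable.mul
      (integrable_interVol hmom a (u • e1 d) b).1) (Eventually.of_forall fun s => ?_)
    rw [Real.norm_of_nonneg (mul_nonneg (hw0 s) (interVol_nonneg _ _ _ _ _))]
    exact mul_le_of_le_one_left (interVol_nonneg _ _ _ _ _) (hw1 s)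
  have e : ∀ u, Iv d F u r₁ r₂ = ∫ s, w s * interVol d 0 (s + r₁) (u • e1 d) (s + r₂) ∂F := by
    intro u
    unfold Iv
    rw [← integral_indicator measurableSet_Ici]
    congr with s
    simp only [hw, indicator]
    split_ifs <;> simp [add_comm]
  refine tendsto_of_tendsto_of_tendsto_of_le_of_le' (Jw hd h hα hmom (min r₁ r₂) hwm hwl)
    (Jw hd h hα hmom (max r₁ r₂) hwm hwl) ?_ ?_
  · filter_upwards [eventually_gt_atTop 0] with u hu
    have := Dn_pos d h hu
    rw [e]
    refine div_le_div_of_nonneg_right ?_ this.le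
    refine integral_mono (hIg _ _ _) (hIg _ _ _) fun s => ?_
    exact mul_le_mul_of_nonneg_left (interVol_mono _ _ _ (by simp) (by simp)) (hw0 s)
  · filter_upwards [eventually_gt_atTop 0] with u hu
    have := Dn_pos d h hu
    rw [e]
    refine div_le_div_of_nonneg_right ?_ this.le
    refine integral_mono (hIg _ _ _) (hIg _ _ _) fun s => ?_
    exact mul_le_mul_of_nonneg_left (interVol_mono _ _ _ (by simp) (by simp)) (hw0 s)

def qp (d : ℕ) (lam : ℝ) (F : Measure ℝ) (u r₁ r₂ : ℝ) : ℝ :=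
  if u ≤ r₁ + r₂ then 0 else hL d lam F r₁ * hL d lam F r₂ * (Real.exp (lam * Iv d F u r₁ r₂) - 1)

def qn (d : ℕ) (lam : ℝ) (F : Measure ℝ) (u r₁ r₂ : ℝ) : ℝ :=
  if u ≤ r₁ + r₂ then hL d lam F r₁ * hL d lam F r₂ else 0

theorem qL_eq (d : ℕ) (lam : ℝ) (F : Measure ℝ) (u r₁ r₂ : ℝ) :
    qL d lam F u r₁ r₂ = qp d lam F u r₁ r₂ - qn d lam F u r₁ r₂ := by
  unfold qL h2L qp qn Iv
  split_ifs <;> ring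

theorem qp_meas {β : Type*} [MeasurableSpace β] (d : ℕ) (lam : ℝ) (F : Measure ℝ) [IsProbabilityMeasure F]
    {u r₁ r₂ : β → ℝ} (hu : Measurable u) (h1 : Measurable r₁) (h2 : Measurable r₂) :
    Measurable (fun b => qp d lam F (u b) (r₁ b) (r₂ b)) := by
  unfold qp
  refine Measurable.ite (measurableSet_le hu (h1.add h2)) measurable_const ?_
  have := (hL_meas d lam F).comp h1
  have := (hL_meas d lam F).comp h2
  have := Iv_meas d F hu h1 h2
  simp only [Function.comp_def] at *
  fun_prop

theorem qn_meas {β : Type*} [MeasurableSpace β] (d : ℕ) (lam : ℝ) (F : Measure ℝ) [IsProbabilityMeasure F]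
    {u r₁ r₂ : β → ℝ} (hu : Measurable u) (h1 : Measurable r₁) (h2 : Measurable r₂) :
    Measurable (fun b => qn d lam F (u b) (r₁ b) (r₂ b)) := by
  unfold qn
  refine Measurable.ite (measurableSet_le hu (h1.add h2)) ?_ measurable_const
  exact ((hL_meas d lam F).comp h1).mul ((hL_meas d lam F).comp h2)

theorem exp_sub_one_le (x : ℝ) : Real.exp x - 1 ≤ x * Real.exp x := by
  have h := Real.add_one_le_exp (-x)
  have h2 : Real.exp (-x) * Real.exp x = 1 := by rw [← Real.exp_add]; simp
  nlinarith [Real.exp_pos x]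

theorem qp_nonneg (d : ℕ) {lam : ℝ} (hlam : 0 < lam) (F : Measure ℝ) (u r₁ r₂ : ℝ) :
    0 ≤ qp d lam F u r₁ r₂ := by
  unfold qp
  split_ifs
  · exact le_rfl
  · have h1 := hL_pos d lam F r₁
    have h2 := hL_pos d lam F r₂
    have := Real.add_one_le_exp (lam * Iv d F u r₁ r₂)
    have h3 := Iv_nonneg d F u r₁ r₂
    have h4 : 0 ≤ Real.exp (lam * Iv d F u r₁ r₂) - 1 := by
      have := mul_nonneg hlam.le h3
      linarith
    positivity

theorem qn_nonneg (d : ℕ) (lam : ℝ) (F : Measure ℝ) (u r₁ r₂ : ℝ) :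
    0 ≤ qn d lam F u r₁ r₂ := by
  unfold qn
  have h1 := hL_pos d lam F r₁
  have h2 := hL_pos d lam F r₂
  split_ifs <;> positivity

theorem qn_le (d : ℕ) {lam : ℝ} (hlam : 0 < lam) (F : Measure ℝ) (u r₁ r₂ : ℝ) :
    qn d lam F u r₁ r₂ ≤ 1 := by
  unfold qn
  have h1 := hL_pos d lam F r₁
  have h2 := hL_pos d lam F r₂
  have h3 := hL_le d hlam F r₁
  have h4 := hL_le d hlam F r₂
  split_ifs
  · nlinarith
  · exact zero_le_one

def Kc (d : ℕ) (lam : ℝ) (F : Measure ℝ) : ℝ :=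
  lam * 2 ^ d * Real.exp (lam * (2 ^ d * Tt d F 0))

theorem qp_bound {d : ℕ} (hd : 0 < d) {lam : ℝ} (hlam : 0 < lam) {F : Measure ℝ} [IsProbabilityMeasure F]
    (hmom : Integrable (fun r : ℝ => r ^ d) F) {u r₁ r₂ v : ℝ} (hr₁ : 0 ≤ r₁)
    (hv : v ≤ max (max r₁ r₂) ((u - r₁ - r₂) / 2)) :
    qp d lam F u r₁ r₂ ≤ Kc d lam F * Tt d F v := by
  have hT := Tt_nonneg d F v
  have hK : 0 ≤ Kc d lam F := by unfold Kc; positivity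
  unfold qp
  split_ifs
  · positivity
  · have h1 := hL_pos d lam F r₁
    have h2 := hL_pos d lam F r₂
    have h1' := hL_le d hlam F r₁
    have h2' := hL_le d hlam F r₂
    have h3 := Iv_nonneg d F u r₁ r₂
    have hI := Iv_bound hd hmom hv
    have hI0 : Iv d F u r₁ r₂ ≤ 2 ^ d * Tt d F 0 := Iv_bound hd hmom (hr₁.trans
      ((le_max_left _ _).trans (le_max_left _ _)))
    have hpp : hL d lam F r₁ * hL d lam F r₂ ≤ 1 := by nlinarith
    calc _ ≤ hL d lam F r₁ * hL d lam F r₂ * (lam * Iv d F u r₁ r₂ * Real.exp (lam * Iv d F u r₁ r₂)) := by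
          gcongr
          exact exp_sub_one_le _
      _ ≤ 1 * (lam * (2 ^ d * Tt d F v) * Real.exp (lam * (2 ^ d * Tt d F 0))) := by
          gcongr
      _ = _ := by unfold Kc; ring

theorem qp_lim {d : ℕ} (hd : 0 < d) {lam : ℝ} (hlam : 0 < lam) {F : Measure ℝ} [IsProbabilityMeasure F]
    {α : ℝ} (h : RV F α)
    (hα : (d : ℝ) < α) (hmom : Integrable (fun r : ℝ => r ^ d) F) (r₁ r₂ : ℝ) :
    Tendsto (fun u => qp d lam F u r₁ r₂ / Dn d F u) atTop
      (nhds (hL d lam F r₁ * hL d lam F r₂ * (lam * cconst d α))) := by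
  have hI := Iv_lim hd h hα hmom r₁ r₂
  have h0 : Tendsto (fun u => Iv d F u r₁ r₂) atTop (nhds 0) := by
    have h1 : Tendsto (fun u => (u - r₁ - r₂) / 2) atTop atTop := by
      apply Tendsto.atTop_div_const (by norm_num)
      simp only [sub_eq_add_neg]
      exact tendsto_atTop_add_const_right _ _ (tendsto_atTop_add_const_right _ _ tendsto_id)
    have h2 := ((Tt_zero hmom).comp h1).const_mul (2 ^ d)
    rw [mul_zero] at h2
    exact tendsto_of_tendsto_of_tendsto_of_le_of_le tendsto_const_nhds h2
      (fun u => Iv_nonneg d F u r₁ r₂) fun u => Iv_bound hd hmom (le_max_right _ _)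
  have he : Tendsto (fun u => Real.exp (lam * Iv d F u r₁ r₂)) atTop (nhds 1) := by
    have h2 := h0.const_mul lam
    rw [mul_zero] at h2
    have := (Real.continuous_exp.tendsto 0).comp h2
    rw [Real.exp_zero] at this
    exact this
  have hp := mul_pos (hL_pos d lam F r₁) (hL_pos d lam F r₂)
  set P := hL d lam F r₁ * hL d lam F r₂ with hP
  have low := (hI.const_mul lam).const_mul P
  have up := (((hI.const_mul lam).mul he).const_mul P)
  rw [mul_one] at up
  refine tendsto_of_tendsto_of_tendsto_of_le_of_le' low up ?_ ?_
  · filter_upwards [eventually_gt_atTop 0, eventually_gt_atTop (r₁ + r₂)] with u hu hu2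
    have := Dn_pos d h hu
    unfold qp
    rw [if_neg (not_le.2 hu2), ← hP, mul_div_assoc, ← mul_div_assoc lam]
    gcongr
    linarith [Real.add_one_le_exp (lam * Iv d F u r₁ r₂)]
  · filter_upwards [eventually_gt_atTop 0, eventually_gt_atTop (r₁ + r₂)] with u hu hu2
    have := Dn_pos d h hu
    unfold qp
    rw [if_neg (not_le.2 hu2), ← hP, mul_div_assoc, ← mul_div_assoc lam, div_mul_eq_mul_div]
    gcongr
    exact exp_sub_one_le _

theorem hL_int (d : ℕ) {lam : ℝ} (hlam : 0 < lam) (F : Measure ℝ) [IsProbabilityMeasure F] :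
    Integrable (hL d lam F) F := by
  refine (integrable_const (1:ℝ)).mono' (hL_meas d lam F).aestronglyMeasurable
    (Eventually.of_forall fun s => ?_)
  rw [Real.norm_of_nonneg (hL_pos _ _ _ _).le]
  exact hL_le d hlam F s

theorem hL_int_pos (d : ℕ) {lam : ℝ} (hlam : 0 < lam) (F : Measure ℝ) [IsProbabilityMeasure F] :
    0 < ∫ r, hL d lam F r ∂F := by
  rw [integral_pos_iff_support_of_nonneg (fun s => (hL_pos _ _ _ _).le) (hL_int d hlam F)]
  have : Function.support (hL d lam F) = univ := by
    ext y
    simp only [Function.mem_support, mem_univ, iff_true]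
    exact (hL_pos _ _ _ _).ne'
  rw [this]; simp

theorem part_i {d : ℕ} {lam : ℝ} (hlam : 0 < lam)
    {F : Measure ℝ} [IsProbabilityMeasure F]
    (hmom : Integrable (fun r : ℝ => r ^ d) F)
    {α : ℝ} (h : RV F α) {ℓ : ℝ → ℝ}
    (htail : ∀ x > 0, tailF F x = ℓ x * x ^ (-α)) :
    Tendsto
      (fun r =>
        tailth lam F (hL d lam F) r /
          ((lam / lamth lam F (hL d lam F)) * ℓ r * r ^ (-α)))
      atTop (nhds 1) := by
  have hp := hL_int_pos d hlam F
  have hl : 0 < lam / lamth lam F (hL d lam F) := by unfold lamth; positivity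
  set A := lam / lamth lam F (hL d lam F)
  have key : Tendsto (fun r => (∫ s in Ioi r, hL d lam F s ∂F) / tailF F r) atTop (nhds 1) := by
    rw [Metric.tendsto_nhds]
    intro ε hε
    obtain ⟨S, hS⟩ := eventually_atTop.1
      (((hL_tendsto lam hmom).eventually_const_lt (by linarith : 1 - ε / 2 < 1)))
    filter_upwards [eventually_gt_atTop 0, eventually_ge_atTop S] with r hr hr2
    have hpos := h.pos r hr
    have hii := (hL_int d hlam F).integrableOn (s := Ioi r)
    have up : ∫ s in Ioi r, hL d lam F s ∂F ≤ tailF F r := by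
      have := setIntegral_mono_on hii (integrable_const (1:ℝ)).integrableOn measurableSet_Ioi
        fun s _ => hL_le d hlam F s
      simpa [tailF, Measure.real] using this
    have low : (1 - ε / 2) * tailF F r ≤ ∫ s in Ioi r, hL d lam F s ∂F := by
      have := setIntegral_mono_on (integrable_const (1 - ε/2:ℝ)).integrableOn hii measurableSet_Ioi
        fun s hs => (hS s (hr2.trans (le_of_lt hs))).le
      simpa [tailF, Measure.real, mul_comm] using this
    rw [Real.dist_eq, abs_lt]
    rw [← div_le_one hpos] at up
    rw [← le_div_iff₀ hpos] at low
    constructor <;> linarith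
  refine key.congr' ?_
  filter_upwards [eventually_gt_atTop 0] with r hr
  rw [mul_assoc, ← htail r hr]
  unfold tailth
  have hpos := h.pos r hr
  change _ = (A * _) / _
  field_simp

theorem Dn_eq {d : ℕ} {F : Measure ℝ} {α : ℝ} {ℓ : ℝ → ℝ}
    (htail : ∀ x > 0, tailF F x = ℓ x * x ^ (-α)) {t : ℝ} (ht : 0 < t) :
    ℓ t * t ^ (-(α - d)) = Dn d F t := by
  unfold Dn
  rw [htail t ht, show -(α - d) = -α + d by ring, Real.rpow_add ht, Real.rpow_natCast]
  ring

theorem ae_nonneg {F : Measure ℝ} (hsupp : F (Iio 0) = 0) : ∀ᵐ r ∂F, 0 ≤ r := by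
  rw [ae_iff]
  convert hsupp using 2
  ext; simp

/-- `∬ qn / Dn → 0`. -/
theorem qn_small {d : ℕ} (hd : 0 < d) {lam : ℝ} (hlam : 0 < lam)
    {F : Measure ℝ} [IsProbabilityMeasure F] {α : ℝ} (h : RV F α) :
    Tendsto (fun u => (∫ p, qn d lam F u p.1 p.2 ∂(F.prod F)) / Dn d F u) atTop (nhds 0) := by
  have hlim : Tendsto (fun u : ℝ => 2 * (tailC F (u * (1/2)) / tailF F u) * (u ^ d)⁻¹) atTop (nhds 0) := by
    have h1 := (rv_tendsto h tendsto_id (n := fun _ => 1/2) (n0 := 1/2) (by norm_num) tendsto_const_nhds).2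
    have h2 : Tendsto (fun u : ℝ => (u ^ d)⁻¹) atTop (nhds 0) :=
      tendsto_inv_atTop_zero.comp (tendsto_pow_atTop hd.ne')
    simpa using (h1.const_mul 2).mul h2
  refine tendsto_of_tendsto_of_tendsto_of_le_of_le' tendsto_const_nhds hlim ?_ ?_
  · filter_upwards [eventually_gt_atTop 0] with u hu
    exact div_nonneg (integral_nonneg fun _ => qn_nonneg _ _ _ _ _ _) (Dn_pos d h hu).le
  · filter_upwards [eventually_gt_atTop 0] with u hu
    have hD := Dn_pos d h hu
    have hpos := h.pos u hu
    have hIg : Integrable (fun p : ℝ × ℝ => (Ici (u * (1/2))).indicator (fun _ => (1:ℝ)) p.1) (F.prod F) := by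
      refine (integrable_const (1:ℝ)).mono' ((measurable_const.indicator measurableSet_Ici).comp measurable_fst).aestronglyMeasurable
        (Eventually.of_forall fun p => ?_)
      simp only [indicator]; split_ifs <;> simp
    have hIg2 : Integrable (fun p : ℝ × ℝ => (Ici (u * (1/2))).indicator (fun _ => (1:ℝ)) p.2) (F.prod F) := by
      refine (integrable_const (1:ℝ)).mono' ((measurable_const.indicator measurableSet_Ici).comp measurable_snd).aestronglyMeasurable
        (Eventually.of_forall fun p => ?_)
      simp only [indicator]; split_ifs <;> simp
    have key : ∫ p, qn d lam F u p.1 p.2 ∂(F.prod F) ≤ 2 * tailC F (u * (1/2)) := by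
      have e1 : ∫ p : ℝ × ℝ, (Ici (u * (1/2))).indicator (fun _ => (1:ℝ)) p.1 ∂(F.prod F) = tailC F (u * (1/2)) := by
        rw [integral_prod _ hIg]
        simp [integral_indicator measurableSet_Ici, tailC, Measure.real]
      have e2 : ∫ p : ℝ × ℝ, (Ici (u * (1/2))).indicator (fun _ => (1:ℝ)) p.2 ∂(F.prod F) = tailC F (u * (1/2)) := by
        rw [integral_prod _ hIg2]
        simp [integral_indicator measurableSet_Ici, tailC, Measure.real]
      calc _ ≤ ∫ p : ℝ × ℝ, ((Ici (u * (1/2))).indicator (fun _ => (1:ℝ)) p.1 +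
              (Ici (u * (1/2))).indicator (fun _ => (1:ℝ)) p.2) ∂(F.prod F) := by
            refine integral_mono_of_nonneg (Eventually.of_forall fun _ => qn_nonneg _ _ _ _ _ _)
              (hIg.add hIg2) (Eventually.of_forall fun p => ?_)
            by_cases hp : u ≤ p.1 + p.2
            · refine (qn_le d hlam F u p.1 p.2).trans ?_
              simp only [indicator, mem_Ici]
              split_ifs <;> linarith
            · simp only [qn, if_neg hp]
              exact add_nonneg (indicator_nonneg (fun _ _ => zero_le_one) _)
                (indicator_nonneg (fun _ _ => zero_le_one) _)
        _ = _ := by rw [integral_add hIg hIg2, e1, e2]; ring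
    calc _ ≤ 2 * tailC F (u * (1/2)) / Dn d F u := by gcongr
      _ = _ := by unfold Dn; field_simp

theorem qp_int {d : ℕ} (hd : 0 < d) {lam : ℝ} (hlam : 0 < lam)
    {F : Measure ℝ} [IsProbabilityMeasure F] (hsupp : F (Iio 0) = 0)
    (hmom : Integrable (fun r : ℝ => r ^ d) F) (u : ℝ) :
    Integrable (fun p : ℝ × ℝ => qp d lam F u p.1 p.2) (F.prod F) := by
  have hae : ∀ᵐ p ∂(F.prod F), 0 ≤ p.1 := Measure.quasiMeasurePreserving_fst.ae (ae_nonneg hsupp)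
  refine (integrable_const (Kc d lam F * Tt d F 0)).mono'
    (qp_meas d lam F measurable_const measurable_fst measurable_snd).aestronglyMeasurable ?_
  filter_upwards [hae] with p hp
  rw [Real.norm_of_nonneg (qp_nonneg d hlam F _ _ _)]
  exact qp_bound hd hlam hmom hp (hp.trans ((le_max_left _ _).trans (le_max_left _ _)))

theorem qn_int {d : ℕ} {lam : ℝ} (hlam : 0 < lam)
    {F : Measure ℝ} [IsProbabilityMeasure F] (u : ℝ) :
    Integrable (fun p : ℝ × ℝ => qn d lam F u p.1 p.2) (F.prod F) := by
  refine (integrable_const (1:ℝ)).mono'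
    (qn_meas d lam F measurable_const measurable_fst measurable_snd).aestronglyMeasurable
    (Eventually.of_forall fun p => ?_)
  rw [Real.norm_of_nonneg (qn_nonneg d lam F _ _ _)]
  exact qn_le d hlam F _ _ _

theorem part_iii {d : ℕ} (hd : 0 < d) {lam : ℝ} (hlam : 0 < lam)
    {F : Measure ℝ} [IsProbabilityMeasure F] (hsupp : F (Iio 0) = 0)
    (hmom : Integrable (fun r : ℝ => r ^ d) F)
    {α : ℝ} (hα : (d : ℝ) < α) (h : RV F α) {ℓ : ℝ → ℝ}
    (htail : ∀ x > 0, tailF F x = ℓ x * x ^ (-α)) :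
    Tendsto
      (fun z : Euc d =>
        xith d lam F (hL d lam F) (qL d lam F) z /
          (lam * cconst d α * ℓ ‖z‖ * ‖z‖ ^ (-(α - d))))
      (comap norm atTop) (nhds 1) := by
  have hae : ∀ᵐ p ∂(F.prod F), 0 ≤ p.1 := Measure.quasiMeasurePreserving_fst.ae (ae_nonneg hsupp)
  obtain ⟨C, hC, hT⟩ := Tt_bound h hα
  have hK : 0 ≤ Kc d lam F := by unfold Kc; positivity
  have hc := cconst_pos hd h hα
  have hp := hL_int_pos d hlam F
  have lim1 : Tendsto (fun u => (∫ p, qp d lam F u p.1 p.2 ∂(F.prod F)) / Dn d F u) atTop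
      (nhds (∫ p, hL d lam F p.1 * hL d lam F p.2 * (lam * cconst d α) ∂(F.prod F))) := by
    simp only [← integral_div]
    refine tendsto_integral_filter_of_dominated_convergence (fun _ => Kc d lam F * C) ?_ ?_
      (integrable_const _) ?_
    · exact Eventually.of_forall fun u =>
        ((qp_meas d lam F measurable_const measurable_fst measurable_snd).div_const _).aestronglyMeasurable
    · filter_upwards [hT, eventually_gt_atTop 0] with u hu hu0
      filter_upwards [hae] with p hp
      have hD := Dn_pos d h hu0
      rw [Real.norm_of_nonneg (div_nonneg (qp_nonneg d hlam F _ _ _) hD.le), div_le_iff₀ hD, mul_assoc]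
      refine (qp_bound hd hlam hmom (v := u / 6) hp ?_).trans (mul_le_mul_of_nonneg_left hu hK)
      by_contra hcon
      simp only [not_le, max_lt_iff] at hcon
      obtain ⟨⟨h1, h2⟩, h3⟩ := hcon
      linarith
    · exact Eventually.of_forall fun p => qp_lim hd hlam h hα hmom p.1 p.2
  have e : ∫ p : ℝ × ℝ, hL d lam F p.1 * hL d lam F p.2 * (lam * cconst d α) ∂(F.prod F)
      = (∫ r, hL d lam F r ∂F) ^ 2 * (lam * cconst d α) := by
    rw [integral_mul_const, integral_prod_mul (hL d lam F) (hL d lam F), sq]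
  rw [e] at lim1
  have lim := (((lim1.sub (qn_small hd hlam h)).const_mul ((lam / lamth lam F (hL d lam F)) ^ 2)).div_const
    (lam * cconst d α)).comp (tendsto_comap (f := (norm : Euc d → ℝ)) (x := atTop))
  have e1 : (lam / lamth lam F (hL d lam F)) ^ 2 * ((∫ r, hL d lam F r ∂F) ^ 2 * (lam * cconst d α) - 0) /
      (lam * cconst d α) = 1 := by
    unfold lamth
    field_simp
    simp
  rw [e1] at lim
  refine lim.congr' ?_
  filter_upwards [tendsto_comap.eventually (eventually_gt_atTop 0)] with z hz
  have hD := Dn_pos d h hz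
  rw [mul_assoc, Dn_eq htail hz]
  simp only [Function.comp]
  have e2 : ∫ r₁, (∫ r₂, qL d lam F ‖z‖ r₁ r₂ ∂F) ∂F =
      ∫ p, qp d lam F ‖z‖ p.1 p.2 ∂(F.prod F) - ∫ p, qn d lam F ‖z‖ p.1 p.2 ∂(F.prod F) := by
    have i1 := qp_int hd hlam hsupp hmom ‖z‖
    have i2 := qn_int (d := d) hlam (F := F) ‖z‖
    have i3 := integral_prod _ (i1.sub i2)
    simp only [Pi.sub_apply] at i3
    rw [← integral_sub i1 i2, i3]
    simp only [qL_eq]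
  unfold xith
  rw [e2]
  field_simp

theorem upper_meas_le (μ : Measure ℝ) [IsFiniteMeasure μ] (t : ENNReal) :
    μ {r | μ (Ici r) ≤ t} ≤ t := by
  have hanti : Antitone (fun x => μ (Ici x)) := fun a b hab => measure_mono (Ici_subset_Ici.2 hab)
  have hm : MeasurableSet {r | μ (Ici r) ≤ t} := measurableSet_le hanti.measurable measurable_const
  rw [hm.measure_eq_iSup_isCompact]
  refine iSup_le fun K => iSup_le fun hKA => iSup_le fun hK => ?_
  rcases K.eq_empty_or_nonempty with rfl | hne
  · simp
  · obtain ⟨k, hk⟩ := hK.exists_isLeast hne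
    exact (measure_mono (fun x hx => hk.2 hx)).trans (hKA hk.1)

theorem fubini_layer' {X : Type*} [MeasurableSpace X] (ν : Measure X) [SFinite ν] (μ : Measure ℝ)
    [SFinite μ] (m : X → ℝ) (hm : Measurable m)
    (f : ℝ → ENNReal) (hf : Measurable f) :
    ∫⁻ s, ν {y | m y ≤ s} * f s ∂μ = ∫⁻ y, ∫⁻ s in Ici (m y), f s ∂μ ∂ν := by
  have hS : MeasurableSet {p : ℝ × X | m p.2 ≤ p.1} :=
    measurableSet_le (hm.comp measurable_snd) measurable_fst
  have h1 : ∀ s, ν {y | m y ≤ s} * f s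
      = ∫⁻ y, {p : ℝ × X | m p.2 ≤ p.1}.indicator (fun p => f p.1) (s, y) ∂ν := by
    intro s
    have : MeasurableSet {y | m y ≤ s} := measurableSet_le hm measurable_const
    rw [mul_comm, ← lintegral_indicator_const this]
    rfl
  simp_rw [h1]
  rw [lintegral_lintegral_swap]
  · congr with y
    rw [← lintegral_indicator measurableSet_Ici]
    rfl
  · exact ((hf.comp measurable_fst).indicator hS).aemeasurable

theorem min_exp_lt (M : ℝ) (hM : 0 ≤ M) :
    IntegrableOn (fun t => min t M * Real.exp (-t)) (Ioi 0) ∧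
    ∫ t in Ioi (0:ℝ), min t M * Real.exp (-t) < 1 := by
  have hG := Real.GammaIntegral_convergent (s := 2) (by norm_num)
  have hG2 := Real.Gamma_eq_integral (s := 2) (by norm_num)
  norm_num at hG hG2
  have hi : IntegrableOn (fun t => min t M * Real.exp (-t)) (Ioi 0) := by
    refine hG.mono' (by fun_prop) ?_
    filter_upwards [ae_restrict_mem measurableSet_Ioi] with t ht
    have ht : 0 < t := ht
    rw [Real.norm_of_nonneg (by positivity), mul_comm]
    gcongr
    exact min_le_left _ _
  refine ⟨hi, ?_⟩
  rw [hG2, ← sub_pos, ← integral_sub hG hi]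
  rw [setIntegral_pos_iff_support_of_nonneg_ae]
  · have hsub : Ioi M ⊆ Function.support (fun t => Real.exp (-t) * t - min t M * Real.exp (-t)) ∩ Ioi 0 := by
      intro t ht
      have ht : M < t := ht
      refine ⟨?_, hM.trans_lt ht⟩
      rw [Function.mem_support, min_eq_right ht.le, mul_comm, ← sub_mul]
      exact mul_ne_zero (by linarith) (Real.exp_pos _).ne'
    refine lt_of_lt_of_le ?_ (measure_mono hsub)
    simp
  · filter_upwards [ae_restrict_mem measurableSet_Ioi] with t ht
    have := min_le_left t M
    have := Real.exp_pos (-t)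
    simp only [Pi.zero_apply]
    nlinarith
  · exact hG.sub hi

theorem exp_upper_lt (μ : Measure ℝ) [IsFiniteMeasure μ] :
    ∫⁻ r, ENNReal.ofReal (Real.exp (-(μ (Ici r)).toReal)) ∂μ < 1 := by
  have hanti : Antitone (fun x => μ (Ici x)) := fun a b hab => measure_mono (Ici_subset_Ici.2 hab)
  have hm : Measurable (fun x => (μ (Ici x)).toReal) := hanti.measurable.ennreal_toReal
  have key := fubini_layer' μ volume (fun x => (μ (Ici x)).toReal) hm
    (fun t => ENNReal.ofReal (Real.exp (-t))) (by fun_prop)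
  have hinner : ∀ a : ℝ, ∫⁻ s in Ici a, ENNReal.ofReal (Real.exp (-s)) = ENNReal.ofReal (Real.exp (-a)) := by
    intro a
    rw [setLIntegral_congr Ioi_ae_eq_Ici.symm, ← ofReal_integral_eq_lintegral_ofReal
      (integrableOn_exp_neg_Ioi a) (Eventually.of_forall fun _ => (Real.exp_pos _).le),
      integral_exp_neg_Ioi]
  simp only [hinner] at key
  rw [← key]
  obtain ⟨hi, hlt⟩ := min_exp_lt (μ univ).toReal ENNReal.toReal_nonneg
  have : ∫⁻ t, μ {y | (μ (Ici y)).toReal ≤ t} * ENNReal.ofReal (Real.exp (-t)) ≤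
      ∫⁻ t in Ioi 0, ENNReal.ofReal (min t (μ univ).toReal * Real.exp (-t)) := by
    rw [setLIntegral_congr Ioi_ae_eq_Ici, ← lintegral_indicator measurableSet_Ici]
    refine lintegral_mono fun t => ?_
    rcases lt_or_ge t 0 with ht | ht
    · have : {y | (μ (Ici y)).toReal ≤ t} = ∅ := by
        ext y
        simp only [mem_ofPred_eq, mem_empty_iff_false, iff_false, not_le]
        exact ht.trans_le ENNReal.toReal_nonneg
      rw [this]; simp
    · rw [indicator_of_mem (by exact ht), ENNReal.ofReal_mul (by positivity)]
      gcongr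
      have e : {y | (μ (Ici y)).toReal ≤ t} = {y | μ (Ici y) ≤ ENNReal.ofReal t} := by
        ext y
        simp only [mem_ofPred_eq]
        rw [ENNReal.le_ofReal_iff_toReal_le (measure_ne_top _ _) ht]
      rw [e, ENNReal.ofReal_min]
      refine le_min (upper_meas_le μ _) ?_
      rw [ENNReal.ofReal_toReal (measure_ne_top _ _)]
      exact measure_mono (subset_univ _)
  refine this.trans_lt ?_
  rw [← ofReal_integral_eq_lintegral_ofReal hi]
  · rw [← ENNReal.ofReal_one]
    exact (ENNReal.ofReal_lt_ofReal_iff one_pos).2 hlt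
  · filter_upwards [ae_restrict_mem measurableSet_Ioi] with t ht
    have ht : 0 < t := ht
    simp only [Pi.zero_apply]
    positivity

theorem pth_lt_one {d : ℕ} {lam : ℝ} (hlam : 0 < lam)
    {F : Measure ℝ} [IsProbabilityMeasure F] (hsupp : F (Iio 0) = 0)
    (hmom : Integrable (fun r : ℝ => r ^ d) F) : pth d lam F (hL d lam F) < 1 := by
  have hib := integrable_ballVol hmom 0
  simp only [add_zero] at hib
  have hi : Integrable (fun s => lam * ballVol d s) F := hib.const_mul lam
  have hnn : ∀ s, 0 ≤ lam * ballVol d s := fun s => mul_nonneg hlam.le (ballVol_nonneg _ _)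
  have hmB : Measurable (ballVol d) := (ballVol_mono d).measurable
  have hm : Measurable (fun s => ENNReal.ofReal (lam * ballVol d s)) := by fun_prop
  set μ := F.withDensity (fun s => ENNReal.ofReal (lam * ballVol d s)) with hμ
  have : IsFiniteMeasure μ := isFiniteMeasure_withDensity_ofReal hi.2
  have hG : ∀ r, (μ (Ici r)).toReal = lam * Tt d F r := by
    intro r
    rw [hμ, withDensity_apply _ measurableSet_Ici, ← ofReal_integral_eq_lintegral_ofReal
      hi.integrableOn (Eventually.of_forall hnn), ENNReal.toReal_ofReal (integral_nonneg hnn),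
      integral_const_mul]
    rfl
  have hle : ∀ᵐ r ∂μ, ENNReal.ofReal (hL d lam F r) ≤ ENNReal.ofReal (Real.exp (-(μ (Ici r)).toReal)) := by
    refine (withDensity_absolutelyContinuous F _).ae_le ?_
    filter_upwards [ae_nonneg hsupp] with r hr
    rw [hG]
    unfold hL Tt
    have hi2 := integrable_ballVol hmom r
    simp only [add_comm _ r] at hi2
    gcongr
    · exact hib.integrableOn
    · exact hi2.integrableOn
    · exact measurableSet_Ici.nullMeasurableSet
    · apply ballVol_mono
      linarith
  have e : pth d lam F (hL d lam F) = (∫⁻ r, ENNReal.ofReal (hL d lam F r) ∂μ).toReal := by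
    unfold pth
    rw [← integral_const_mul, integral_eq_lintegral_of_nonneg_ae]
    · rw [hμ, lintegral_withDensity_eq_lintegral_mul _ hm (hL_meas d lam F).ennreal_ofReal]
      congr 2 with r
      simp only [Pi.mul_apply]
      rw [← ENNReal.ofReal_mul (hnn r), mul_assoc]
    · refine Eventually.of_forall fun r => ?_
      have := hnn r
      have := (hL_pos d lam F r).le
      simp only [Pi.zero_apply]
      rw [← mul_assoc]
      positivity
    · exact ((hmB.mul (hL_meas d lam F)).const_mul lam).aestronglyMeasurable
  rw [e]
  have := (lintegral_mono_ae hle).trans_lt (exp_upper_lt μ)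
  rw [← ENNReal.toReal_one]
  exact (ENNReal.toReal_lt_toReal this.ne_top ENNReal.one_ne_top).2 this

theorem V_lint {d : ℕ} (r₁ r₂ : ℝ) :
    ∫⁻ x : Euc d, volume (closedBall (0 : Euc d) r₁ ∩ closedBall x r₂) =
      volume (closedBall (0 : Euc d) r₁) * volume (closedBall (0 : Euc d) r₂) := by
  have hS : MeasurableSet {p : Euc d × Euc d | ‖p.2‖ ≤ r₁ ∧ ‖p.2 - p.1‖ ≤ r₂} := by
    apply MeasurableSet.inter
    · exact measurableSet_le (f := fun p : Euc d × Euc d => ‖p.2‖) (g := fun p => r₁)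
        (by fun_prop) (by fun_prop)
    · exact measurableSet_le (f := fun p : Euc d × Euc d => ‖p.2 - p.1‖) (g := fun p => r₂)
        (by fun_prop) (by fun_prop)
  have h1 := Measure.prod_apply (μ := (volume : Measure (Euc d))) (ν := (volume : Measure (Euc d))) hS
  have h2 := Measure.prod_apply_symm (μ := (volume : Measure (Euc d))) (ν := (volume : Measure (Euc d))) hS
  have e1 : ∀ x : Euc d, Prod.mk x ⁻¹' {p : Euc d × Euc d | ‖p.2‖ ≤ r₁ ∧ ‖p.2 - p.1‖ ≤ r₂} =
      closedBall (0 : Euc d) r₁ ∩ closedBall x r₂ := by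
    intro x; ext y; simp [dist_eq_norm]
  have e2 : ∀ y : Euc d, volume ((fun x => (x, y)) ⁻¹' {p : Euc d × Euc d | ‖p.2‖ ≤ r₁ ∧ ‖p.2 - p.1‖ ≤ r₂}) =
      (closedBall (0 : Euc d) r₁).indicator (fun _ => volume (closedBall (0 : Euc d) r₂)) y := by
    intro y
    by_cases hy : ‖y‖ ≤ r₁
    · rw [indicator_of_mem (by simpa using hy), ← Measure.addHaar_closedBall_center _ y]
      congr 1
      ext x; simp [hy, dist_eq_norm, norm_sub_rev]
    · rw [indicator_of_notMem (by simpa using hy)]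
      convert measure_empty (μ := (volume : Measure (Euc d)))
      ext x; simp [hy]
  simp only [e1] at h1
  simp only [e2] at h2
  rw [← h1, h2, lintegral_indicator_const measurableSet_closedBall, mul_comm]

theorem V_meas {d : ℕ} (r₁ r₂ : ℝ) : Measurable (fun x : Euc d => interVol d 0 r₁ x r₂) :=
  measurable_interVol measurable_const measurable_id measurable_const

theorem V_int {d : ℕ} (r₁ r₂ : ℝ) : Integrable (fun x : Euc d => interVol d 0 r₁ x r₂) ∧
    ∫ x : Euc d, interVol d 0 r₁ x r₂ = ballVol d r₁ * ballVol d r₂ := by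
  have hm := V_meas (d := d) r₁ r₂
  have e : ∀ x : Euc d, ENNReal.ofReal (interVol d 0 r₁ x r₂) =
      volume (closedBall (0 : Euc d) r₁ ∩ closedBall x r₂) := fun x =>
    ENNReal.ofReal_toReal (inter_ne_top _ _ _ _)
  constructor
  · refine ⟨hm.aestronglyMeasurable, ?_⟩
    rw [hasFiniteIntegral_iff_ofReal (Eventually.of_forall fun x => interVol_nonneg _ _ _ _ _)]
    simp only [e]
    rw [V_lint]
    exact ENNReal.mul_lt_top measure_closedBall_lt_top measure_closedBall_lt_top
  · rw [integral_eq_lintegral_of_nonneg_ae (Eventually.of_forall fun x => interVol_nonneg _ _ _ _ _)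
      hm.aestronglyMeasurable]
    simp only [e]
    rw [V_lint, ENNReal.toReal_mul]
    rfl

def Wp (d : ℕ) (lam : ℝ) (F : Measure ℝ) (z : Euc d) (r₁ r₂ : ℝ) : ℝ :=
  ∫ x, interVol d 0 r₁ x r₂ * qp d lam F ‖x - z‖ r₁ r₂

def Wn (d : ℕ) (z : Euc d) (r₁ r₂ : ℝ) : ℝ :=
  ∫ x, interVol d 0 r₁ x r₂ * (if ‖x - z‖ ≤ r₁ + r₂ then 1 else 0)

theorem Vqp_int {d : ℕ} (hd : 0 < d) {lam : ℝ} (hlam : 0 < lam) {F : Measure ℝ} [IsProbabilityMeasure F]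
    (hmom : Integrable (fun r : ℝ => r ^ d) F) (z : Euc d) {r₁ r₂ : ℝ} (hr₁ : 0 ≤ r₁) :
    Integrable (fun x => interVol d 0 r₁ x r₂ * qp d lam F ‖x - z‖ r₁ r₂) := by
  refine ((V_int r₁ r₂).1.mul_const (Kc d lam F * Tt d F 0)).mono'
    ((V_meas r₁ r₂).mul (qp_meas d lam F (by fun_prop) measurable_const measurable_const)).aestronglyMeasurable
    (Eventually.of_forall fun x => ?_)
  have h1 := interVol_nonneg d 0 r₁ x r₂
  rw [Real.norm_of_nonneg (mul_nonneg h1 (qp_nonneg d hlam F _ _ _))]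
  refine mul_le_mul_of_nonneg_left ?_ h1
  exact qp_bound hd hlam hmom hr₁ (hr₁.trans ((le_max_left _ _).trans (le_max_left _ _)))

theorem ite_meas {d : ℕ} (z : Euc d) (R : ℝ) : Measurable (fun x : Euc d => if ‖x - z‖ ≤ R then (1:ℝ) else 0) :=
  Measurable.ite (measurableSet_le (by fun_prop) measurable_const) measurable_const measurable_const

theorem Vn_int {d : ℕ} (z : Euc d) (r₁ r₂ : ℝ) :
    Integrable (fun x => interVol d 0 r₁ x r₂ * (if ‖x - z‖ ≤ r₁ + r₂ then (1:ℝ) else 0)) := by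
  refine (V_int r₁ r₂).1.mono' ((V_meas r₁ r₂).mul (ite_meas z _)).aestronglyMeasurable
    (Eventually.of_forall fun x => ?_)
  have h1 := interVol_nonneg d 0 r₁ x r₂
  split_ifs <;> simp [abs_of_nonneg h1, h1]

theorem Wp_nonneg (d : ℕ) {lam : ℝ} (hlam : 0 < lam) (F : Measure ℝ) (z : Euc d) (r₁ r₂ : ℝ) :
    0 ≤ Wp d lam F z r₁ r₂ :=
  integral_nonneg fun _ => mul_nonneg (interVol_nonneg _ _ _ _ _) (qp_nonneg d hlam F _ _ _)

theorem Wn_nonneg (d : ℕ) (z : Euc d) (r₁ r₂ : ℝ) : 0 ≤ Wn d z r₁ r₂ :=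
  integral_nonneg fun _ => mul_nonneg (interVol_nonneg _ _ _ _ _) (by split_ifs <;> norm_num)

theorem Wn_le_BB (d : ℕ) (z : Euc d) (r₁ r₂ : ℝ) : Wn d z r₁ r₂ ≤ ballVol d r₁ * ballVol d r₂ := by
  rw [← (V_int (d := d) r₁ r₂).2]
  refine integral_mono (Vn_int z r₁ r₂) (V_int r₁ r₂).1 fun x => ?_
  have h1 := interVol_nonneg d 0 r₁ x r₂
  simp only
  split_ifs <;> simp [h1]

theorem Wn_symm (d : ℕ) (z : Euc d) (r₁ r₂ : ℝ) : Wn d z r₁ r₂ = Wn d z r₂ r₁ := by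
  unfold Wn
  simp only [interVol_symm d r₁ _ r₂, add_comm r₁ r₂]

theorem ind_int {d : ℕ} (z : Euc d) (R : ℝ) (b : ℝ) :
    Integrable ((closedBall (0 : Euc d) R ∩ closedBall z R).indicator (fun _ => b)) ∧
    ∫ x, (closedBall (0 : Euc d) R ∩ closedBall z R).indicator (fun _ => b) x = b * interVol d 0 R z R := by
  have hm : MeasurableSet (closedBall (0 : Euc d) R ∩ closedBall z R) :=
    measurableSet_closedBall.inter measurableSet_closedBall
  constructor
  · rw [integrable_indicator_iff hm]
    exact integrableOn_const (inter_ne_top _ _ _ _)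
  · rw [integral_indicator_const _ hm, smul_eq_mul, mul_comm]
    rfl

theorem Wn_upper (d : ℕ) (z : Euc d) (r₁ r₂ : ℝ) :
    Wn d z r₁ r₂ ≤ ballVol d r₁ * interVol d 0 (r₂ + r₁) z (r₂ + r₁) := by
  rw [← (ind_int z (r₂ + r₁) (ballVol d r₁)).2]
  refine integral_mono (Vn_int z r₁ r₂) (ind_int z (r₂ + r₁) (ballVol d r₁)).1 fun x => ?_
  have h1 := interVol_nonneg d 0 r₁ x r₂
  have hb := ballVol_nonneg d r₁
  simp only [indicator, mem_inter_iff, mem_closedBall, dist_eq_norm, sub_zero]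
  by_cases hx : ‖x‖ ≤ r₂ + r₁
  · by_cases hxz : ‖x - z‖ ≤ r₁ + r₂
    · rw [if_pos hxz, if_pos ⟨hx, by linarith⟩, mul_one]
      exact interVol_le _ _ _ _
    · rw [if_neg hxz, mul_zero]
      split_ifs <;> simp [hb]
  · rw [interVol_zero d (by linarith), zero_mul]
    split_ifs <;> simp [hb]

theorem Wn_lower (d : ℕ) (z : Euc d) {r₁ : ℝ} (hr₁ : 0 ≤ r₁) (r₂ : ℝ) :
    ballVol d r₁ * interVol d 0 (r₂ + -r₁) z (r₂ + -r₁) ≤ Wn d z r₁ r₂ := by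
  rw [← (ind_int z (r₂ + -r₁) (ballVol d r₁)).2]
  refine integral_mono (ind_int z (r₂ + -r₁) (ballVol d r₁)).1 (Vn_int z r₁ r₂) fun x => ?_
  have h1 := interVol_nonneg d 0 r₁ x r₂
  simp only [indicator, mem_inter_iff, mem_closedBall, dist_eq_norm, sub_zero]
  split_ifs with h2 h3
  · rw [mul_one, interVol_full d (by linarith [h2.1])]
  · exact absurd (by linarith [h2.2]) h3
  · simpa using h1
  · simp

theorem Wn_meas (d : ℕ) (z : Euc d) : Measurable (fun p : ℝ × ℝ => Wn d z p.1 p.2) := by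
  have : Measurable (fun p : (ℝ × ℝ) × Euc d => interVol d 0 p.1.1 p.2 p.1.2 *
      (if ‖p.2 - z‖ ≤ p.1.1 + p.1.2 then (1:ℝ) else 0)) := by
    apply (measurable_interVol (by fun_prop) (by fun_prop) (by fun_prop)).mul
    refine Measurable.ite (measurableSet_le (by fun_prop) (by fun_prop)) measurable_const measurable_const
  exact (this.stronglyMeasurable.integral_prod_right' (ν := (volume : Measure (Euc d)))).measurable

theorem Wp_meas (d : ℕ) (lam : ℝ) (F : Measure ℝ) [IsProbabilityMeasure F] (z : Euc d) :
    Measurable (fun p : ℝ × ℝ => Wp d lam F z p.1 p.2) := by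
  have : Measurable (fun p : (ℝ × ℝ) × Euc d => interVol d 0 p.1.1 p.2 p.1.2 *
      qp d lam F ‖p.2 - z‖ p.1.1 p.1.2) := by
    apply (measurable_interVol (by fun_prop) (by fun_prop) (by fun_prop)).mul
    exact qp_meas d lam F (by fun_prop) (by fun_prop) (by fun_prop)
  exact (this.stronglyMeasurable.integral_prod_right' (ν := (volume : Measure (Euc d)))).measurable

theorem inner_eq {d : ℕ} (hd : 0 < d) {lam : ℝ} (hlam : 0 < lam) {F : Measure ℝ} [IsProbabilityMeasure F]
    (hmom : Integrable (fun r : ℝ => r ^ d) F) (z : Euc d) {r₁ r₂ : ℝ} (hr₁ : 0 ≤ r₁) :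
    ∫ x, interVol d 0 r₁ x r₂ * qL d lam F ‖x - z‖ r₁ r₂ =
      Wp d lam F z r₁ r₂ - hL d lam F r₁ * hL d lam F r₂ * Wn d z r₁ r₂ := by
  unfold Wp Wn
  rw [← integral_const_mul, ← integral_sub (Vqp_int hd hlam hmom z hr₁) ((Vn_int z r₁ r₂).const_mul _)]
  congr with x
  rw [qL_eq]
  unfold qn
  split_ifs <;> ring

theorem BB_int {d : ℕ} {F : Measure ℝ} [IsProbabilityMeasure F]
    (hmom : Integrable (fun r : ℝ => r ^ d) F) :
    Integrable (fun p : ℝ × ℝ => ballVol d p.1 * ballVol d p.2) (F.prod F) := by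
  have hib := integrable_ballVol hmom 0
  simp only [add_zero] at hib
  exact hib.mul_prod hib

/-- pointwise bound of the positive part -/
theorem Vqp_bound {d : ℕ} (hd : 0 < d) {lam : ℝ} (hlam : 0 < lam) {F : Measure ℝ} [IsProbabilityMeasure F]
    (hmom : Integrable (fun r : ℝ => r ^ d) F) (z x : Euc d) {r₁ r₂ : ℝ} (hr₁ : 0 ≤ r₁) :
    interVol d 0 r₁ x r₂ * qp d lam F ‖x - z‖ r₁ r₂ ≤
      interVol d 0 r₁ x r₂ * (Kc d lam F * Tt d F (‖z‖ / 6)) := by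
  rcases lt_or_ge (r₁ + r₂) ‖x‖ with hx | hx
  · rw [interVol_zero d hx]; simp
  · refine mul_le_mul_of_nonneg_left ?_ (interVol_nonneg _ _ _ _ _)
    refine qp_bound hd hlam hmom hr₁ ?_
    by_contra hcon
    simp only [not_le, max_lt_iff] at hcon
    obtain ⟨⟨h1, h2⟩, h3⟩ := hcon
    have := norm_sub_le x (x - z)
    rw [sub_sub_cancel] at this
    linarith

theorem Wp_bound {d : ℕ} (hd : 0 < d) {lam : ℝ} (hlam : 0 < lam) {F : Measure ℝ} [IsProbabilityMeasure F]
    (hmom : Integrable (fun r : ℝ => r ^ d) F) (z : Euc d) {r₁ r₂ : ℝ} (hr₁ : 0 ≤ r₁) :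
    Wp d lam F z r₁ r₂ ≤ ballVol d r₁ * ballVol d r₂ * (Kc d lam F * Tt d F (‖z‖ / 6)) := by
  rw [← (V_int (d := d) r₁ r₂).2, ← integral_mul_const]
  exact integral_mono (Vqp_int hd hlam hmom z hr₁) ((V_int r₁ r₂).1.mul_const _)
    fun x => Vqp_bound hd hlam hmom z x hr₁

theorem shift_lim {d : ℕ} {F : Measure ℝ} [IsProbabilityMeasure F] {α : ℝ} (h : RV F α) (x : Euc d) :
    Tendsto (fun z : Euc d => ‖x - z‖) (comap norm atTop) atTop ∧
    Tendsto (fun z : Euc d => Dn d F ‖x - z‖ / Dn d F ‖z‖) (comap norm atTop) (nhds 1) := by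
  have hn : Tendsto (fun z : Euc d => ‖z‖) (comap norm atTop) atTop := tendsto_comap
  have h1 : Tendsto (fun z : Euc d => ‖x - z‖) (comap norm atTop) atTop := by
    refine tendsto_atTop_mono (f := fun z : Euc d => ‖z‖ + -‖x‖) (fun z => ?_)
      (tendsto_atTop_add_const_right _ _ hn)
    have := norm_sub_le x (x - z)
    rw [sub_sub_cancel] at this
    linarith
  refine ⟨h1, ?_⟩
  have h2 : Tendsto (fun z : Euc d => ‖x - z‖ / ‖z‖) (comap norm atTop) (nhds 1) := by
    have h3 : Tendsto (fun z : Euc d => ‖x‖ / ‖z‖) (comap norm atTop) (nhds 0) :=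
      tendsto_const_nhds.div_atTop hn
    refine tendsto_of_tendsto_of_tendsto_of_le_of_le' (by simpa using h3.const_sub 1)
      (by simpa using h3.const_add 1) ?_ ?_
    · filter_upwards [hn.eventually_gt_atTop 0] with z hz
      have := norm_sub_le x (x - z)
      rw [sub_sub_cancel] at this
      rw [sub_le_iff_le_add, ← add_div, le_div_iff₀ hz]
      linarith
    · filter_upwards [hn.eventually_gt_atTop 0] with z hz
      have := norm_sub_le x z
      rw [div_le_iff₀ hz, add_mul, div_mul_cancel₀ _ hz.ne']
      linarith
  have h4 := (rv_tendsto h hn one_pos h2).1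
  have h5 := (h2.pow d).mul h4
  simp only [one_pow, Real.one_rpow, mul_one] at h5
  refine h5.congr' ?_
  filter_upwards [hn.eventually_gt_atTop 0] with z hz
  have := h.pos _ hz
  unfold Dn
  rw [mul_div_cancel₀ _ hz.ne', div_pow]
  field_simp

theorem Wp_lim {d : ℕ} (hd : 0 < d) {lam : ℝ} (hlam : 0 < lam) {F : Measure ℝ} [IsProbabilityMeasure F]
    (hmom : Integrable (fun r : ℝ => r ^ d) F) {α : ℝ} (h : RV F α) (hα : (d : ℝ) < α)
    {r₁ : ℝ} (r₂ : ℝ) (hr₁ : 0 ≤ r₁) :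
    Tendsto (fun z : Euc d => Wp d lam F z r₁ r₂ / Dn d F ‖z‖) (comap norm atTop)
      (nhds (ballVol d r₁ * ballVol d r₂ * (hL d lam F r₁ * hL d lam F r₂ * (lam * cconst d α)))) := by
  obtain ⟨C, hC, hT⟩ := Tt_bound h hα
  have hK : 0 ≤ Kc d lam F := by unfold Kc; positivity
  have hn : Tendsto (fun z : Euc d => ‖z‖) (comap norm atTop) atTop := tendsto_comap
  rw [← (V_int (d := d) r₁ r₂).2, ← integral_mul_const]
  unfold Wp
  simp only [← integral_div]
  refine tendsto_integral_filter_of_dominated_convergence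
    (fun x => interVol d 0 r₁ x r₂ * (Kc d lam F * C)) ?_ ?_ ((V_int r₁ r₂).1.mul_const _) ?_
  · exact Eventually.of_forall fun z =>
      ((Vqp_int hd hlam hmom z hr₁).div_const _).aestronglyMeasurable
  · filter_upwards [hn.eventually hT, hn.eventually_gt_atTop 0] with z hz hz0
    refine Eventually.of_forall fun x => ?_
    have hD := Dn_pos d h hz0
    have h1 := interVol_nonneg d 0 r₁ x r₂
    rw [Real.norm_of_nonneg (div_nonneg (mul_nonneg h1 (qp_nonneg d hlam F _ _ _)) hD.le),
      div_le_iff₀ hD]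
    refine (Vqp_bound hd hlam hmom z x hr₁).trans ?_
    rw [mul_assoc, mul_assoc]
    gcongr
  · refine Eventually.of_forall fun x => ?_
    obtain ⟨s1, s2⟩ := shift_lim (d := d) h x
    have h3 := ((((qp_lim hd hlam h hα hmom r₁ r₂).comp s1).mul s2).const_mul (interVol d 0 r₁ x r₂))
    rw [mul_one] at h3
    refine h3.congr' ?_
    filter_upwards [s1.eventually_gt_atTop 0, hn.eventually_gt_atTop 0] with z hz hz0
    have hD := Dn_pos d h hz0
    have hD2 := Dn_pos d h hz
    simp only [Function.comp]
    field_simp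

theorem pos_lim {d : ℕ} (hd : 0 < d) {lam : ℝ} (hlam : 0 < lam) {F : Measure ℝ} [IsProbabilityMeasure F]
    (hsupp : F (Iio 0) = 0)
    (hmom : Integrable (fun r : ℝ => r ^ d) F) {α : ℝ} (h : RV F α) (hα : (d : ℝ) < α) :
    (∀ z, Integrable (fun p : ℝ × ℝ => Wp d lam F z p.1 p.2) (F.prod F)) ∧
    Tendsto (fun z : Euc d => (∫ p, Wp d lam F z p.1 p.2 ∂(F.prod F)) / Dn d F ‖z‖) (comap norm atTop)
      (nhds ((∫ r, ballVol d r * hL d lam F r ∂F) ^ 2 * (lam * cconst d α))) := by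
  have hae : ∀ᵐ p ∂(F.prod F), 0 ≤ p.1 := Measure.quasiMeasurePreserving_fst.ae (ae_nonneg hsupp)
  obtain ⟨C, hC, hT⟩ := Tt_bound h hα
  have hK : 0 ≤ Kc d lam F := by unfold Kc; positivity
  have hn : Tendsto (fun z : Euc d => ‖z‖) (comap norm atTop) atTop := tendsto_comap
  constructor
  · intro z
    refine ((BB_int hmom).mul_const (Kc d lam F * Tt d F (‖z‖ / 6))).mono'
      (Wp_meas d lam F z).aestronglyMeasurable ?_
    filter_upwards [hae] with p hp
    rw [Real.norm_of_nonneg (Wp_nonneg d hlam F _ _ _)]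
    exact Wp_bound hd hlam hmom z hp
  · have e : (∫ r, ballVol d r * hL d lam F r ∂F) ^ 2 * (lam * cconst d α) =
        ∫ p : ℝ × ℝ, ballVol d p.1 * ballVol d p.2 *
          (hL d lam F p.1 * hL d lam F p.2 * (lam * cconst d α)) ∂(F.prod F) := by
      rw [sq, ← integral_prod_mul (μ := F) (ν := F) (fun r => ballVol d r * hL d lam F r)
        (fun r => ballVol d r * hL d lam F r), ← integral_mul_const]
      congr with p
      ring
    rw [e]
    simp only [← integral_div]
    refine tendsto_integral_filter_of_dominated_convergence
      (fun p => ballVol d p.1 * ballVol d p.2 * (Kc d lam F * C)) ?_ ?_ ((BB_int hmom).mul_const _) ?_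
    · exact Eventually.of_forall fun z => ((Wp_meas d lam F z).div_const _).aestronglyMeasurable
    · filter_upwards [hn.eventually hT, hn.eventually_gt_atTop 0] with z hz hz0
      filter_upwards [hae] with p hp
      have hD := Dn_pos d h hz0
      have h1 := ballVol_nonneg d p.1
      have h2 := ballVol_nonneg d p.2
      rw [Real.norm_of_nonneg (div_nonneg (Wp_nonneg d hlam F _ _ _) hD.le), div_le_iff₀ hD]
      refine (Wp_bound hd hlam hmom z hp).trans ?_
      rw [mul_assoc _ (Kc d lam F * C), mul_assoc (Kc d lam F)]
      gcongr
    · filter_upwards [hae] with p hp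
      exact Wp_lim hd hlam hmom h hα p.2 hp

/-- symmetric half weight -/
def chi (p : ℝ × ℝ) : ℝ := if p.1 < p.2 then 1 else if p.2 < p.1 then 0 else 1 / 2

theorem chi_meas : Measurable chi := by
  refine Measurable.ite (measurableSet_lt (by fun_prop) (by fun_prop)) measurable_const ?_
  exact Measurable.ite (measurableSet_lt (by fun_prop) (by fun_prop)) measurable_const measurable_const

theorem chi_nonneg (p : ℝ × ℝ) : 0 ≤ chi p := by
  unfold chi; split_ifs <;> norm_num

theorem chi_le (p : ℝ × ℝ) : chi p ≤ 1 := by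
  unfold chi; split_ifs <;> norm_num

theorem chi_add (p : ℝ × ℝ) : chi p + chi p.swap = 1 := by
  unfold chi
  simp only [Prod.fst_swap, Prod.snd_swap]
  split_ifs <;> first | (exfalso; linarith) | norm_num

def hhW (d : ℕ) (lam : ℝ) (F : Measure ℝ) (z : Euc d) (p : ℝ × ℝ) : ℝ :=
  hL d lam F p.1 * hL d lam F p.2 * Wn d z p.1 p.2

theorem hhW_nonneg (d : ℕ) (lam : ℝ) (F : Measure ℝ) (z : Euc d) (p : ℝ × ℝ) : 0 ≤ hhW d lam F z p :=
  mul_nonneg (mul_nonneg (hL_pos d lam F _).le (hL_pos d lam F _).le) (Wn_nonneg d z _ _)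

theorem hhW_le (d : ℕ) {lam : ℝ} (hlam : 0 < lam) (F : Measure ℝ) (z : Euc d) (p : ℝ × ℝ) :
    hhW d lam F z p ≤ Wn d z p.1 p.2 := by
  have h1 := hL_le d hlam F p.1
  have h2 := hL_le d hlam F p.2
  have h3 := (hL_pos d lam F p.1).le
  have h4 := (hL_pos d lam F p.2).le
  exact mul_le_of_le_one_left (Wn_nonneg d z _ _) (mul_le_one₀ h1 h4 h2)

theorem hhW_meas (d : ℕ) (lam : ℝ) (F : Measure ℝ) [IsProbabilityMeasure F] (z : Euc d) :
    Measurable (hhW d lam F z) := by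
  have := hL_meas d lam F
  have := Wn_meas d z
  unfold hhW
  fun_prop

theorem hhW_swap (d : ℕ) (lam : ℝ) (F : Measure ℝ) (z : Euc d) (p : ℝ × ℝ) :
    hhW d lam F z p.swap = hhW d lam F z p := by
  unfold hhW
  simp only [Prod.fst_swap, Prod.snd_swap]
  rw [Wn_symm d z p.2 p.1]; ring

theorem hhW_int {d : ℕ} {lam : ℝ} (hlam : 0 < lam) {F : Measure ℝ} [IsProbabilityMeasure F]
    (hmom : Integrable (fun r : ℝ => r ^ d) F) (z : Euc d) :
    Integrable (hhW d lam F z) (F.prod F) := by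
  refine (BB_int hmom).mono' (hhW_meas d lam F z).aestronglyMeasurable (Eventually.of_forall fun p => ?_)
  rw [Real.norm_of_nonneg (hhW_nonneg _ _ _ _ _)]
  exact (hhW_le d hlam F z p).trans (Wn_le_BB _ _ _ _)

theorem chW_int {d : ℕ} {lam : ℝ} (hlam : 0 < lam) {F : Measure ℝ} [IsProbabilityMeasure F]
    (hmom : Integrable (fun r : ℝ => r ^ d) F) (z : Euc d) :
    Integrable (fun p => chi p * hhW d lam F z p) (F.prod F) := by
  refine (hhW_int hlam hmom z).mono (chi_meas.mul (hhW_meas d lam F z)).aestronglyMeasurable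
    (Eventually.of_forall fun p => ?_)
  rw [norm_mul, Real.norm_of_nonneg (chi_nonneg p)]
  exact mul_le_of_le_one_left (norm_nonneg _) (chi_le p)

theorem hhW_half {d : ℕ} {lam : ℝ} (hlam : 0 < lam) {F : Measure ℝ} [IsProbabilityMeasure F]
    (hmom : Integrable (fun r : ℝ => r ^ d) F) (z : Euc d) :
    ∫ p, hhW d lam F z p ∂(F.prod F) = 2 * ∫ p, chi p * hhW d lam F z p ∂(F.prod F) := by
  have i1 := chW_int hlam hmom z
  have i2 := i1.swap
  simp only [Function.comp_def] at i2
  have e := integral_prod_swap (μ := F) (ν := F) (fun p => chi p * hhW d lam F z p)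
  rw [two_mul]
  nth_rw 2 [← e]
  rw [← integral_add i1 i2]
  congr with p
  simp only [hhW_swap]
  rw [← add_mul, chi_add, one_mul]

theorem chW_sec_int {d : ℕ} {lam : ℝ} (hlam : 0 < lam) {F : Measure ℝ} [IsProbabilityMeasure F]
    (hmom : Integrable (fun r : ℝ => r ^ d) F) (z : Euc d) (r₁ : ℝ) :
    Integrable (fun r₂ => chi (r₁, r₂) * hhW d lam F z (r₁, r₂)) F := by
  have hib := integrable_ballVol hmom 0
  simp only [add_zero] at hib
  refine (hib.const_mul (ballVol d r₁)).mono' ((chi_meas.comp measurable_prodMk_left).mul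
    ((hhW_meas d lam F z).comp measurable_prodMk_left)).aestronglyMeasurable
    (Eventually.of_forall fun r₂ => ?_)
  rw [Real.norm_of_nonneg (mul_nonneg (chi_nonneg _) (hhW_nonneg _ _ _ _ _))]
  exact (mul_le_of_le_one_left (hhW_nonneg _ _ _ _ _) (chi_le _)).trans
    ((hhW_le d hlam F z _).trans (Wn_le_BB _ _ _ _))

theorem sec_bound {d : ℕ} {lam : ℝ} (hlam : 0 < lam) {F : Measure ℝ} [IsProbabilityMeasure F]
    (hmom : Integrable (fun r : ℝ => r ^ d) F) (z : Euc d) (r₁ : ℝ) :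
    ∫ r₂, chi (r₁, r₂) * hhW d lam F z (r₁, r₂) ∂F ≤ ballVol d r₁ * (2 ^ d * Tt d F (‖z‖ / 6)) := by
  have hib := integrable_ballVol hmom 0
  simp only [add_zero] at hib
  unfold Tt
  rw [← integral_indicator measurableSet_Ici, ← integral_const_mul, ← integral_const_mul]
  refine integral_mono (chW_sec_int hlam hmom z r₁)
    (((hib.indicator measurableSet_Ici).const_mul _).const_mul _) fun r₂ => ?_
  have hB := ballVol_nonneg d r₁
  have hB2 := ballVol_nonneg d r₂
  by_cases h : r₂ < r₁
  · have : chi (r₁, r₂) = 0 := by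
      unfold chi; rw [if_neg (by simpa using h.le), if_pos (by simpa using h)]
    simp only [this, zero_mul]
    exact mul_nonneg hB (mul_nonneg (by positivity) (indicator_nonneg (fun _ _ => ballVol_nonneg _ _) _))
  push Not at h
  refine (mul_le_of_le_one_left (hhW_nonneg _ _ _ _ _) (chi_le _)).trans
    ((hhW_le d hlam F z _).trans ((Wn_upper _ _ _ _).trans ?_))
  simp only
  refine mul_le_mul_of_nonneg_left ?_ hB
  by_cases h2 : ‖z‖ / 6 ≤ r₂
  · rw [indicator_of_mem (by simpa using h2), ← ballVol_two_mul]
    exact (interVol_le _ _ _ _).trans (ballVol_mono d (by linarith))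
  · rw [indicator_of_notMem (by simpa using h2)]
    push Not at h2
    rw [interVol_zero]
    · simp
    · have := norm_nonneg z
      linarith

theorem sec_lim {d : ℕ} (hd : 0 < d) {lam : ℝ} (hlam : 0 < lam) {F : Measure ℝ} [IsProbabilityMeasure F]
    (hmom : Integrable (fun r : ℝ => r ^ d) F) {α : ℝ} (h : RV F α) (hα : (d : ℝ) < α) {r₁ : ℝ}
    (hr : 0 ≤ r₁) :
    Tendsto (fun z : Euc d => (∫ r₂, chi (r₁, r₂) * hhW d lam F z (r₁, r₂) ∂F) / Dn d F ‖z‖)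
      (comap norm atTop) (nhds (ballVol d r₁ * hL d lam F r₁ * cconst d α)) := by
  have hn : Tendsto (fun z : Euc d => ‖z‖) (comap norm atTop) atTop := tendsto_comap
  set w : ℝ → ℝ := fun s => chi (r₁, s) * hL d lam F s with hw
  have hwm : Measurable w := (chi_meas.comp measurable_prodMk_left).mul (hL_meas d lam F)
  have hwt : Tendsto w atTop (nhds 1) := by
    refine (hL_tendsto lam hmom).congr' ?_
    filter_upwards [eventually_gt_atTop r₁] with s hs
    simp [hw, chi, hs]
  have hw0 : ∀ s, 0 ≤ w s := fun s => mul_nonneg (chi_nonneg _) (hL_pos d lam F s).le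
  have hw1 : ∀ s, w s ≤ 1 := fun s => mul_le_one₀ (chi_le _) (hL_pos d lam F s).le (hL_le d hlam F s)
  have hIg : ∀ (a : ℝ) (z : Euc d), Integrable (fun s => w s * interVol d 0 (s + a) z (s + a)) F := by
    intro a z
    refine (integrable_interVol hmom a z a).mono (hwm.mul
      (measurable_interVol (by fun_prop) (by fun_prop) (by fun_prop))).aestronglyMeasurable
      (Eventually.of_forall fun s => ?_)
    rw [norm_mul, Real.norm_of_nonneg (hw0 s)]
    exact mul_le_of_le_one_left (norm_nonneg _) (hw1 s)
  have hlim : ∀ a : ℝ, Tendsto (fun z : Euc d => ballVol d r₁ * hL d lam F r₁ *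
      ((∫ s, w s * interVol d 0 (s + a) z (s + a) ∂F) / Dn d F ‖z‖)) (comap norm atTop)
      (nhds (ballVol d r₁ * hL d lam F r₁ * cconst d α)) := by
    intro a
    refine Tendsto.const_mul _ ?_
    refine ((Jw hd h hα hmom a hwm hwt).comp hn).congr fun z => ?_
    simp only [Function.comp]
    congr 2 with s
    rw [interVol_norm hd _ z]
  have hb : 0 ≤ hL d lam F r₁ := (hL_pos d lam F r₁).le
  refine tendsto_of_tendsto_of_tendsto_of_le_of_le' (hlim (-r₁)) (hlim r₁) ?_ ?_
  · filter_upwards [hn.eventually_gt_atTop 0] with z hz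
    have hD := Dn_pos d h hz
    rw [← mul_div_assoc]
    gcongr
    rw [← integral_const_mul]
    refine integral_mono ((hIg _ z).const_mul _) (chW_sec_int hlam hmom z r₁) fun s => ?_
    have h1 := mul_le_mul_of_nonneg_left (Wn_lower d z hr s) (mul_nonneg hb (hw0 s))
    simp only [hhW, hw] at h1 ⊢
    linarith
  · filter_upwards [hn.eventually_gt_atTop 0] with z hz
    have hD := Dn_pos d h hz
    rw [← mul_div_assoc]
    gcongr
    rw [← integral_const_mul]
    refine integral_mono (chW_sec_int hlam hmom z r₁) ((hIg _ z).const_mul _) fun s => ?_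
    have h1 := mul_le_mul_of_nonneg_left (Wn_upper d z r₁ s) (mul_nonneg hb (hw0 s))
    simp only [hhW, hw] at h1 ⊢
    linarith

theorem neg_lim {d : ℕ} (hd : 0 < d) {lam : ℝ} (hlam : 0 < lam) {F : Measure ℝ} [IsProbabilityMeasure F]
    (hsupp : F (Iio 0) = 0)
    (hmom : Integrable (fun r : ℝ => r ^ d) F) {α : ℝ} (h : RV F α) (hα : (d : ℝ) < α) :
    Tendsto (fun z : Euc d => (∫ p, hhW d lam F z p ∂(F.prod F)) / Dn d F ‖z‖) (comap norm atTop)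
      (nhds (2 * ((∫ r, ballVol d r * hL d lam F r ∂F) * cconst d α))) := by
  have hn : Tendsto (fun z : Euc d => ‖z‖) (comap norm atTop) atTop := tendsto_comap
  obtain ⟨C, hC, hT⟩ := Tt_bound h hα
  have hib := integrable_ballVol hmom 0
  simp only [add_zero] at hib
  simp only [hhW_half hlam hmom, mul_div_assoc]
  refine Tendsto.const_mul _ ?_
  have e : ∀ z, ∫ p, chi p * hhW d lam F z p ∂(F.prod F) =
      ∫ r₁, ∫ r₂, chi (r₁, r₂) * hhW d lam F z (r₁, r₂) ∂F ∂F := fun z =>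
    integral_prod _ (chW_int hlam hmom z)
  simp only [e]
  rw [← integral_mul_const]
  simp only [← integral_div]
  refine Tendsto.congr (f₁ := fun z : Euc d => ∫ r₁, (∫ r₂, chi (r₁, r₂) * hhW d lam F z (r₁, r₂) ∂F)
    / Dn d F ‖z‖ ∂F) (fun z => by simp only [integral_div]) ?_
  refine tendsto_integral_filter_of_dominated_convergence
    (fun r₁ => ballVol d r₁ * (2 ^ d * C)) ?_ ?_ (hib.mul_const _) ?_
  · refine Eventually.of_forall fun z => ?_
    exact (((chi_meas.mul (hhW_meas d lam F z)).stronglyMeasurable.integral_prod_right'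
      (ν := F)).measurable.div_const _).aestronglyMeasurable
  · filter_upwards [hn.eventually hT, hn.eventually_gt_atTop 0] with z hz hz0
    refine Eventually.of_forall fun r₁ => ?_
    have hD := Dn_pos d h hz0
    have h1 := ballVol_nonneg d r₁
    rw [Real.norm_of_nonneg (div_nonneg (integral_nonneg fun _ =>
      mul_nonneg (chi_nonneg _) (hhW_nonneg _ _ _ _ _)) hD.le), div_le_iff₀ hD]
    refine (sec_bound hlam hmom z r₁).trans ?_
    rw [mul_assoc, mul_assoc]
    gcongr
  · filter_upwards [ae_nonneg hsupp] with r hr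
    exact sec_lim hd hlam hmom h hα hr

theorem part_ii {d : ℕ} (hd : 0 < d) {lam : ℝ} (hlam : 0 < lam)
    {F : Measure ℝ} [IsProbabilityMeasure F] (hsupp : F (Iio 0) = 0)
    (hmom : Integrable (fun r : ℝ => r ^ d) F)
    {α : ℝ} (hα : (d : ℝ) < α) (h : RV F α) {ℓ : ℝ → ℝ}
    (htail : ∀ x > 0, tailF F x = ℓ x * x ^ (-α)) :
    Tendsto
      (fun z : Euc d =>
        kth d lam F (hL d lam F) (qL d lam F) z /
          (lam * cconst d α * (1 - pth d lam F (hL d lam F)) ^ 2 * ℓ ‖z‖ *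
            ‖z‖ ^ (-(α - d))))
      (comap norm atTop) (nhds 1) := by
  have hn : Tendsto (fun z : Euc d => ‖z‖) (comap norm atTop) atTop := tendsto_comap
  have hc := cconst_pos hd h hα
  have hp := pth_lt_one hlam hsupp hmom
  obtain ⟨hpi, hpl⟩ := pos_lim hd hlam hsupp hmom h hα
  have hnl := neg_lim hd hlam hsupp hmom h hα
  have hfl : Tendsto (fun z : Euc d => (∫ r, interVol d 0 r z r * hL d lam F r ∂F) / Dn d F ‖z‖)
      (comap norm atTop) (nhds (cconst d α)) := by
    refine ((Jw hd h hα hmom 0 (hL_meas d lam F) (hL_tendsto lam hmom)).comp hn).congr fun z => ?_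
    simp only [Function.comp, add_zero]
    congr 2 with s
    rw [interVol_norm hd _ z, mul_comm]
  have e : ∀ z : Euc d, ∫ r₁, (∫ r₂, (∫ x, interVol d 0 r₁ x r₂ * qL d lam F (‖x - z‖) r₁ r₂) ∂F) ∂F =
      (∫ p, Wp d lam F z p.1 p.2 ∂(F.prod F)) - ∫ p, hhW d lam F z p ∂(F.prod F) := by
    intro z
    have i3 := integral_prod _ ((hpi z).sub (hhW_int hlam hmom z))
    simp only [Pi.sub_apply] at i3
    rw [← integral_sub (hpi z) (hhW_int hlam hmom z), i3]
    refine integral_congr_ae ?_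
    filter_upwards [ae_nonneg hsupp] with r₁ hr₁
    congr with r₂
    exact inner_eq hd hlam hmom z hr₁
  have hk := (hfl.const_mul lam).add ((hpl.sub hnl).const_mul (lam ^ 2))
  have hA : lam * cconst d α * (1 - pth d lam F (hL d lam F)) ^ 2 ≠ 0 := by
    have : 0 < 1 - pth d lam F (hL d lam F) := by linarith
    positivity
  have hk2 := hk.div_const (lam * cconst d α * (1 - pth d lam F (hL d lam F)) ^ 2)
  have e2 : (lam * cconst d α + lam ^ 2 * ((∫ r, ballVol d r * hL d lam F r ∂F) ^ 2 * (lam * cconst d α) -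
      2 * ((∫ r, ballVol d r * hL d lam F r ∂F) * cconst d α))) /
      (lam * cconst d α * (1 - pth d lam F (hL d lam F)) ^ 2) = 1 := by
    rw [div_eq_one_iff_eq hA]
    unfold pth
    ring
  rw [e2] at hk2
  refine hk2.congr' ?_
  filter_upwards [hn.eventually_gt_atTop 0] with z hz
  have hD := (Dn_pos d h hz).ne'
  unfold kth
  rw [e z, mul_assoc _ (ℓ ‖z‖), Dn_eq htail hz]
  field_simp

/-- Large grains retained: the radius tail keeps the exponent `α`, and the
covariance of the grain cover and the two-point correlation of the grain centers
decay with exponent `α - d`. -/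
theorem stmt15 (d : ℕ) (hd : 0 < d) (lam : ℝ) (hlam : 0 < lam)
    (F : Measure ℝ) [IsProbabilityMeasure F] (hsupp : F (Iio 0) = 0)
    (hmom : Integrable (fun r : ℝ => r ^ d) F)
    (α : ℝ) (hα : (d : ℝ) < α)
    (ℓ : ℝ → ℝ) (hℓ : SlowlyVarying ℓ)
    (htail : ∀ x > 0, tailF F x = ℓ x * x ^ (-α)) :
    Tendsto
      (fun r =>
        tailth lam F (hL d lam F) r /
          ((lam / lamth lam F (hL d lam F)) * ℓ r * r ^ (-α)))
      atTop (nhds 1) ∧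
    Tendsto
      (fun z : Euc d =>
        kth d lam F (hL d lam F) (qL d lam F) z /
          (lam * cconst d α * (1 - pth d lam F (hL d lam F)) ^ 2 * ℓ ‖z‖ *
            ‖z‖ ^ (-(α - d))))
      (comap norm atTop) (nhds 1) ∧
    Tendsto
      (fun z : Euc d =>
        xith d lam F (hL d lam F) (qL d lam F) z /
          (lam * cconst d α * ℓ ‖z‖ * ‖z‖ ^ (-(α - d))))
      (comap norm atTop) (nhds 1) := by
  have h := rv_of hℓ htail
  exact ⟨part_i hlam hmom h htail, part_ii hd hlam hsupp hmom hα h htail,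
    part_iii hd hlam hsupp hmom hα h htail⟩
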